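/- arXiv:math/0608747 — 2 statements merged into one kernel-verified Lean document; each statement's English description precedes it below -/
import Mathlib

section
/- Let K be an infinite field and let (T,(X_1,…,X_s)) be a tableau with substitution of dimension n = (n_1,…,n_m) ∈ ℕ^m, with n_1 + ⋯ + n_m even. Set k_j = #{a ∈ T | φ(a) = j} for 1 ≤ j ≤ s, and for each j choose a_j ∈ T with φ(a_j) = j. Then bpf_T(X_1,…,X_s) = ± P_{k_1,…,k_s}(X_1^{a_1'', a_1'},…,X_s^{a_s'', a_s'}); in particular, bpf_T(X_1,…,X_s) equals, up to sign, a block partial linearization of the pfaffian satisfying the condition Σ_{j: p_j = i} k_j + Σ_{j: q_j = i} k_j = n_i for all 1 ≤ i ≤ m, where p_j = a_j'' and q_j = a_j'. -/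
open scoped BigOperators
set_option linter.unusedVariables false

attribute [local instance] Classical.propDecidable

/-- The cells of a shape of dimension `n : ι → ℕ`: the column `i` has `n i` cells. -/
abbrev TabCell {ι : Type} (n : ι → ℕ) : Type := Σ i : ι, Fin (n i)

/-- A tableau with substitution `(T,(X_1,…,X_s))` of dimension `n : ι → ℕ` with entries
in `A`.  Cells are paired by the involution `mate` (each pair of cells is an arrow going
from the tail cell, where `isTail` holds, to the head cell); `lab` assigns to every
arrow (encoded via either of its two cells) its index `φ ∈ {1,…,s}`; `X j` is the matrix
assigned to the arrows with label `j`, which is an `n_{a''} × n_{a'}` matrix where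
`colTail j = a''` and `colHead j = a'` are the tail and head columns of those arrows. -/
structure TabSub (A : Type) [CommRing A] (ι : Type) [Fintype ι] [DecidableEq ι]
    (n : ι → ℕ) (s : ℕ) where
  mate : Equiv.Perm (TabCell n)
  isTail : TabCell n → Bool
  lab : TabCell n → Fin s
  colTail : Fin s → ι
  colHead : Fin s → ι
  X : ∀ j : Fin s, Matrix (Fin (n (colTail j))) (Fin (n (colHead j))) A
  mate_ne : ∀ c, mate c ≠ c
  mate_invol : ∀ c, mate (mate c) = c
  isTail_mate : ∀ c, isTail (mate c) = !isTail c
  lab_mate : ∀ c, lab (mate c) = lab c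
  lab_surj : ∀ j : Fin s, ∃ c, isTail c = true ∧ lab c = j
  colTail_eq : ∀ c, isTail c = true → colTail (lab c) = c.1
  colHead_eq : ∀ c, isTail c = true → colHead (lab c) = (mate c).1

namespace TabSub

variable {A : Type} [CommRing A] {ι : Type} [Fintype ι] [DecidableEq ι] {n : ι → ℕ} {s : ℕ}

/-- The entry of a (rectangular) matrix at a pair of natural number indices, extended
by zero outside the range. -/
def castEntry {a b : ι} (M : Matrix (Fin (n a)) (Fin (n b)) A) (i j : ℕ) : A :=
  if h : i < n a ∧ j < n b then M ⟨i, h.1⟩ ⟨j, h.2⟩ else 0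

/-- The set of tail cells of a tableau; tail cells are in bijection with arrows. -/
noncomputable def tails (T : TabSub A ι n s) : Finset (TabCell n) :=
  Finset.univ.filter fun c => T.isTail c = true

/-- `sgn(π_1)⋯sgn(π_m)` for a tuple of permutations of the columns. -/
def sgnT (π : ∀ i : ι, Equiv.Perm (Fin (n i))) : ℤ :=
  ∏ i, (Equiv.Perm.sign (π i) : ℤ)

/-- The factor `(X_{φ(a)})_{π_{a''}(''a), π_{a'}('a)}` contributed by the arrow with
tail cell `c`. -/
def entry (T : TabSub A ι n s) (π : ∀ i : ι, Equiv.Perm (Fin (n i))) (c : TabCell n) : A :=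
  castEntry (T.X (T.lab c)) (π c.1 c.2 : Fin (n c.1)).1
    ((π (T.mate c).1 (T.mate c).2 : Fin (n (T.mate c).1)).1)

/-- `bpf⁰_T(X_1,…,X_s)`: the sum over all tuples of permutations. -/
noncomputable def bpf0 (T : TabSub A ι n s) : A :=
  ∑ π : ∀ i : ι, Equiv.Perm (Fin (n i)), sgnT π • ∏ c ∈ T.tails, T.entry π c

/-- The condition on a tuple of permutations appearing in `bpf`: whenever
`φ(a) = φ(b)` and `''a < ''b` then `π_i(''a) < π_i(''b)`. -/
def SortedPi (T : TabSub A ι n s) (π : ∀ i : ι, Equiv.Perm (Fin (n i))) : Prop :=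
  ∀ c ∈ T.tails, ∀ d ∈ T.tails, T.lab c = T.lab d → (c.2 : ℕ) < (d.2 : ℕ) →
    ((π c.1 c.2 : Fin (n c.1)) : ℕ) < ((π d.1 d.2 : Fin (n d.1)) : ℕ)

/-- `bpf_T(X_1,…,X_s)`. -/
noncomputable def bpf (T : TabSub A ι n s) : A :=
  ∑ π ∈ Finset.univ.filter T.SortedPi, sgnT π • ∏ c ∈ T.tails, T.entry π c

/-- Conjugating a tableau with substitution by a column-preserving permutation of the
cells. -/
def permTab (T : TabSub A ι n s) (ρ : Equiv.Perm (TabCell n))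
    (hρ : ∀ c, (ρ c).1 = c.1) : TabSub A ι n s where
  mate := (ρ.symm.trans T.mate).trans ρ
  isTail c := T.isTail (ρ.symm c)
  lab c := T.lab (ρ.symm c)
  colTail := T.colTail
  colHead := T.colHead
  X := T.X
  mate_ne c h := by
    refine T.mate_ne (ρ.symm c) ?_
    simpa using congrArg ρ.symm h
  mate_invol c := by simp [T.mate_invol]
  isTail_mate c := by simpa using T.isTail_mate (ρ.symm c)
  lab_mate c := by simpa using T.lab_mate (ρ.symm c)
  lab_surj j := by
    obtain ⟨c, hc1, hc2⟩ := T.lab_surj j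
    exact ⟨ρ c, by simpa using hc1, by simpa using hc2⟩
  colTail_eq c h := by
    have h1 := T.colTail_eq (ρ.symm c) h
    have h2 : (ρ (ρ.symm c)).1 = (ρ.symm c).1 := hρ (ρ.symm c)
    simpa [h1] using h2.symm
  colHead_eq c h := by
    have h1 := T.colHead_eq (ρ.symm c) h
    have h2 := hρ (T.mate (ρ.symm c))
    simp only [Equiv.trans_apply]
    rw [h1, h2]

/-- The permutation of the cells permuting the cells of column `q` by `τ`. -/
def colPerm (n : ι → ℕ) (q : ι) (τ : Equiv.Perm (Fin (n q))) : Equiv.Perm (TabCell n) :=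
  Equiv.sigmaCongrRight fun i =>
    if h : i = q then ((finCongr (congrArg n h)).permCongr.symm τ) else Equiv.refl _

/-- The tableau `T^τ` obtained from `T` by permuting the cells of column `q` by `τ`. -/
def tw (T : TabSub A ι n s) (q : ι) (τ : Equiv.Perm (Fin (n q))) : TabSub A ι n s :=
  T.permTab (colPerm n q τ) (fun _ => rfl)

end TabSub

namespace TabSub

variable {A : Type} [CommRing A] {ι : Type} [Fintype ι] [DecidableEq ι] {n : ι → ℕ} {s : ℕ}

/-! ### Oriented arrows, paths, and the matrices they carry

An element `a ∈t T` (an arrow of `T` or the transpose of one) is encoded by a cell `c`: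
the oriented arrow with tail cell `c` and head cell `T.mate c`.  If `c` is a tail cell
this is the arrow itself, otherwise it is the transpose of an arrow. -/

/-- The letter `φ(a) ∈ M_T` of an oriented arrow: its label together with a flag telling
whether it is transposed. -/
def letter (T : TabSub A ι n s) (c : TabCell n) : Fin s × Bool := (T.lab c, !T.isTail c)

/-- The word `φ(a_1)⋯φ(a_r) ∈ M_T` of a word of oriented arrows. -/
def word (T : TabSub A ι n s) (l : List (TabCell n)) : List (Fin s × Bool) :=
  l.map T.letter

/-- The entries (as a function on natural number indices, extended by zero) of the
matrix `X_{φ(a)}` assigned to an oriented arrow: rows are indexed by its tail column,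
columns by its head column; for a transposed arrow this is the transposed matrix. -/
def matOf (T : TabSub A ι n s) (c : TabCell n) : ℕ → ℕ → A :=
  fun i j => if T.isTail c then castEntry (T.X (T.lab c)) i j else castEntry (T.X (T.lab c)) j i

/-- The product of a list of `ℕ×ℕ`-indexed matrices, all summations being over
`Finset.range B`. -/
def matListProd (B : ℕ) : List (ℕ → ℕ → A) → ℕ → ℕ → A
  | [] => fun i j => if i = j then 1 else 0
  | f :: fs => fun i j => ∑ p ∈ Finset.range B, f i p * matListProd B fs p j

/-- A bound exceeding the sizes of all matrices involved. -/
def dimBound (n : ι → ℕ) [Fintype ι] : ℕ := ∑ i, n i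

/-- The entries of the product matrix `X_{φ(a_1)}⋯X_{φ(a_r)}` of a word of oriented
arrows (the product being `0` if the sizes do not match). -/
def pathMat (T : TabSub A ι n s) (l : List (TabCell n)) : ℕ → ℕ → A :=
  matListProd (dimBound n) (l.map T.matOf)

/-- The trace of the matrix of a (closed) word of oriented arrows. -/
def pathTr (T : TabSub A ι n s) (l : List (TabCell n)) : A :=
  ∑ p ∈ Finset.range (dimBound n), T.pathMat l p p

/-- The entries of the matrix `X_u` of a word `u ∈ M_T` in the letters
`1,…,s,1ᵗ,…,sᵗ` (the product being `0` if the sizes do not match). -/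
def wordMat (T : TabSub A ι n s) (w : List (Fin s × Bool)) : ℕ → ℕ → A :=
  matListProd (dimBound n)
    (w.map fun p => fun i j =>
      if p.2 then castEntry (T.X p.1) j i else castEntry (T.X p.1) i j)

/-- `σ_k(X)`: the coefficient in the characteristic polynomial defined by
`det(λE − X) = λ^n − σ_1(X)λ^{n−1} + ⋯ + (−1)^n σ_n(X)`. -/
noncomputable def sigmaCoeff (N : ℕ) (M : Matrix (Fin N) (Fin N) A) (k : ℕ) : A :=
  (-1) ^ k * (Matrix.charpoly M).coeff (N - k)

/-- `σ_k(X_u)` for a word `u ∈ M_T`. -/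
noncomputable def wordSigma (T : TabSub A ι n s) (w : List (Fin s × Bool)) (k : ℕ) : A :=
  sigmaCoeff (dimBound n) (Matrix.of fun i j : Fin (dimBound n) => T.wordMat w i j) k

/-- Oriented arrows `a_1, a_2` are successive (with respect to the distinguished columns
`q_1, q_2`): `a_1', a_2'' ∈ {q_1,q_2}`, `a_1' ≠ a_2''` and `'a_1 = ''a_2`. -/
def Succ (T : TabSub A ι n s) (q1 q2 : ι) (c d : TabCell n) : Prop :=
  ((T.mate c).1 = q1 ∨ (T.mate c).1 = q2) ∧ (d.1 = q1 ∨ d.1 = q2) ∧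
    (T.mate c).1 ≠ d.1 ∧ ((T.mate c).2 : ℕ) = (d.2 : ℕ)

/-- A path in `T` with respect to the columns `q_1` and `q_2`: a (nonempty, repetition
free) word of oriented arrows in which consecutive arrows are successive. -/
def IsPath (T : TabSub A ι n s) (q1 q2 : ι) (l : List (TabCell n)) : Prop :=
  l ≠ [] ∧ l.Chain' (T.Succ q1 q2) ∧ l.Nodup

/-- An open path: a path passing through the columns `q_1,q_2` whose first tail and
last head lie outside `{q_1,q_2}`. -/
def IsOpenPath (T : TabSub A ι n s) (q1 q2 : ι) (l : List (TabCell n)) : Prop :=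
  T.IsPath q1 q2 l ∧ 2 ≤ l.length ∧ ∀ h : l ≠ [],
    ((l.head h).1 ≠ q1 ∧ (l.head h).1 ≠ q2) ∧
    ((T.mate (l.getLast h)).1 ≠ q1 ∧ (T.mate (l.getLast h)).1 ≠ q2)

/-- A closed path: a path whose last and first arrows are also successive. -/
def IsClosedPath (T : TabSub A ι n s) (q1 q2 : ι) (l : List (TabCell n)) : Prop :=
  T.IsPath q1 q2 l ∧ ∀ h : l ≠ [], T.Succ q1 q2 (l.getLast h) (l.head h)

/-- The transpose `aᵗ = a_rᵗ⋯a_1ᵗ` of a word of oriented arrows. -/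
def tp (T : TabSub A ι n s) (l : List (TabCell n)) : List (TabCell n) :=
  (l.map T.mate).reverse

/-- Equality of words of oriented arrows up to transposition (`=t`). -/
def eqT (T : TabSub A ι n s) (l l' : List (TabCell n)) : Prop :=
  l = l' ∨ l = T.tp l'

/-- Equality of words of oriented arrows up to cyclic permutation and transposition
(`=ct`). -/
def eqCT (T : TabSub A ι n s) (l l' : List (TabCell n)) : Prop :=
  l.IsRotated l' ∨ l.IsRotated (T.tp l')

/-- `R` is a set of representatives of the open paths of `T` (w.r.t. `q_1,q_2`) modulo
the `=t`-equivalence. -/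
def OpenReps (T : TabSub A ι n s) (q1 q2 : ι) (R : Finset (List (TabCell n))) : Prop :=
  (∀ l ∈ R, T.IsOpenPath q1 q2 l) ∧
  ∀ l, T.IsOpenPath q1 q2 l → ∃! l', l' ∈ R ∧ T.eqT l l'

/-- `R` is a set of representatives of the closed paths of `T` (w.r.t. `q_1,q_2`)
modulo the `=ct`-equivalence. -/
def ClosedReps (T : TabSub A ι n s) (q1 q2 : ι) (R : Finset (List (TabCell n))) : Prop :=
  (∀ l ∈ R, T.IsClosedPath q1 q2 l) ∧
  ∀ l, T.IsClosedPath q1 q2 l → ∃! l', l' ∈ R ∧ T.eqCT l l'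

/-- `tr(T_cl) = ∏_{a ∈ T_cl} tr(X_{φ(a)})` for a set `R` of representatives of the
closed paths. -/
noncomputable def trClosed (T : TabSub A ι n s) (R : Finset (List (TabCell n))) : A :=
  ∏ l ∈ R, T.pathTr l

end TabSub

/-! ### Words in the free monoid `M_T` -/

/-- The transpose `uᵗ` of a word `u ∈ M_T` in the letters `1,…,s,1ᵗ,…,sᵗ`. -/
def wtp {s : ℕ} (w : List (Fin s × Bool)) : List (Fin s × Bool) :=
  (w.map fun p => (p.1, !p.2)).reverse

/-- Equality of words in `M_T` up to transposition (`=t`). -/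
def weqT {s : ℕ} (w w' : List (Fin s × Bool)) : Prop := w = w' ∨ w = wtp w'

/-- Equality of words in `M_T` up to cyclic permutation and transposition (`=ct`). -/
def weqCT {s : ℕ} (w w' : List (Fin s × Bool)) : Prop :=
  w.IsRotated w' ∨ w.IsRotated (wtp w')

/-- A word in a free monoid is primitive if it is not a power (with at least two
factors) of a word. -/
def PrimitiveWord {α : Type*} (w : List α) : Prop :=
  w ≠ [] ∧ ∀ (u : List α) (r : ℕ), 2 ≤ r → w ≠ (List.replicate r u).flatten

namespace TabSub

variable {A : Type} [CommRing A] {ι : Type} [Fintype ι] [DecidableEq ι] {n : ι → ℕ} {s : ℕ}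

/-! ### The tableau `T̃` -/

/-- The inclusion of the cells of the shape with the columns `q_1, q_2` deleted into the
cells of the original shape. -/
def embCell (q1 q2 : ι) (c : TabCell (fun i : {i : ι // i ≠ q1 ∧ i ≠ q2} => n i.1)) :
    TabCell n := ⟨c.1.1, c.2⟩

/-- The word in `M_T` corresponding to an arrow of `T̃` with tail cell `c'`: for an old
arrow (Case A) it is the single letter `φ(a)`; for an arrow coming from an open path
`l ∈ Ro` starting at `c'` (Case B) it is `φ(l)`. -/
noncomputable def tildeWord (T : TabSub A ι n s) (q1 q2 : ι)
    (Ro : Finset (List (TabCell n)))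
    (c' : TabCell (fun i : {i : ι // i ≠ q1 ∧ i ≠ q2} => n i.1)) : List (Fin s × Bool) :=
  if ((T.mate (embCell q1 q2 c')).1 ≠ q1 ∧ (T.mate (embCell q1 q2 c')).1 ≠ q2) then
    [T.letter (embCell q1 q2 c')]
  else
    T.word ((Ro.filter fun l => l.head? = some (embCell q1 q2 c')).toList.headI)

end TabSub

namespace TabSub

variable {A : Type} [CommRing A] {ι : Type} [Fintype ι] [DecidableEq ι] {n : ι → ℕ} {s : ℕ}

/-- `D` is (a tableau with substitution equal to) the tableau `T̃` associated with `T`,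
the columns `q_1, q_2`, and the set `Ro` of representatives of open paths.  Its arrows
are the arrows of `T` lying entirely outside the columns `q_1, q_2` (Case A, carrying
the same matrices), together with one arrow for each open path `l ∈ Ro`, going from the
tail of the first arrow of `l` to the head of its last arrow and carrying the matrix
`X_{φ(l)}` (Case B); two arrows of `D` carry the same label iff the corresponding words
in `M_T` coincide. -/
def IsTilde (T : TabSub A ι n s) (q1 q2 : ι) (Ro : Finset (List (TabCell n))) {t : ℕ}
    (D : TabSub A {i : ι // i ≠ q1 ∧ i ≠ q2} (fun i => n i.1) t) : Prop :=
  (∀ c' : TabCell (fun i : {i : ι // i ≠ q1 ∧ i ≠ q2} => n i.1),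
    ((T.mate (embCell q1 q2 c')).1 ≠ q1 ∧ (T.mate (embCell q1 q2 c')).1 ≠ q2) →
      D.isTail c' = T.isTail (embCell q1 q2 c') ∧
      embCell q1 q2 (D.mate c') = T.mate (embCell q1 q2 c') ∧
      ∀ i j, D.matOf c' i j = T.matOf (embCell q1 q2 c') i j) ∧
  (∀ l ∈ Ro, ∀ (h : l ≠ []) (h1 : (l.head h).1 ≠ q1 ∧ (l.head h).1 ≠ q2),
      D.isTail ⟨⟨(l.head h).1, h1⟩, (l.head h).2⟩ = true ∧
      embCell q1 q2 (D.mate ⟨⟨(l.head h).1, h1⟩, (l.head h).2⟩) = T.mate (l.getLast h) ∧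
      ∀ i j, D.matOf ⟨⟨(l.head h).1, h1⟩, (l.head h).2⟩ i j = T.pathMat l i j) ∧
  (∀ c' d', D.isTail c' = true → D.isTail d' = true →
      (D.lab c' = D.lab d' ↔ tildeWord T q1 q2 Ro c' = tildeWord T q1 q2 Ro d'))

end TabSub

/-! ### Quadruples and the sets `S_τ`, `S_{β,γ,b,c}` -/

/-- The data of a quadruple `(β,γ,b,c)` with `β ∈ ℕ^p`, `γ ∈ ℕ^q` and `b`, `c`
sequences of words in `M_T`. -/
structure QuadData (s : ℕ) where
  p : ℕ
  q : ℕ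
  β : Fin p → ℕ
  γ : Fin q → ℕ
  b : Fin p → List (Fin s × Bool)
  c : Fin q → List (Fin s × Bool)

namespace QuadData

variable {s : ℕ}

/-- `(β,γ,b,c)` is a `T`-quadruple: the `b_i`, `c_j` are primitive, the `b_i` are
pairwise different with respect to `=t` and the `c_j` pairwise different with respect
to `=ct`. -/
def IsQuad (Q : QuadData s) : Prop :=
  (∀ i, PrimitiveWord (Q.b i)) ∧ (∀ j, PrimitiveWord (Q.c j)) ∧
  (∀ i i', i ≠ i' → ¬ weqT (Q.b i) (Q.b i')) ∧
  (∀ j j', j ≠ j' → ¬ weqCT (Q.c j) (Q.c j'))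

/-- The multiset `{{b_1,…,b_1,…,b_p,…,b_p}}` with `b_i` of multiplicity `β_i`. -/
def mB (Q : QuadData s) : Multiset (List (Fin s × Bool)) :=
  ∑ i, Multiset.replicate (Q.β i) (Q.b i)

/-- The multiset `{{c_1,…,c_1,…,c_q,…,c_q}}` with `c_j` of multiplicity `γ_j`. -/
def mC (Q : QuadData s) : Multiset (List (Fin s × Bool)) :=
  ∑ j, Multiset.replicate (Q.γ j) (Q.c j)

/-- Equivalence of quadruples: the associated multisets agree up to `=t` (for `b`)
and up to `=ct` (for `c`). -/
def Equiv (Q Q' : QuadData s) : Prop :=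
  Multiset.Rel weqT Q.mB Q'.mB ∧ Multiset.Rel weqCT Q.mC Q'.mC

end QuadData

namespace TabSub

variable {A : Type} [CommRing A] {ι : Type} [Fintype ι] [DecidableEq ι] {n : ι → ℕ} {s : ℕ}

/-- The multiset `φ(T_o)` (or `φ(T_cl)`) of words in `M_T` of a set `R` of
representative paths. -/
def wordsOf (T : TabSub A ι n s) (R : Finset (List (TabCell n))) :
    Multiset (List (Fin s × Bool)) :=
  R.val.map T.word

/-- `ξ` witnesses the `T`-admissibility of the quadruple `Q`, with respect to the given
families `Ro ξ`, `Rcl ξ` of representatives of the open and closed paths of `T^ξ`: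
`φ(T^ξ_o) =t {{b_i with multiplicity β_i}}` and
`φ(T^ξ_cl) =ct {{c_j with multiplicity γ_j}}`. -/
def Witness (T : TabSub A ι n s) (q1 q2 : ι)
    (Ro Rcl : Finset (List (TabCell n))) (Q : QuadData s) : Prop :=
  Multiset.Rel weqT (T.wordsOf Ro) Q.mB ∧ Multiset.Rel weqCT (T.wordsOf Rcl) Q.mC

/-- The quadruple `Q` is `T`-admissible. -/
def Admissible (T : TabSub A ι n s) (q1 q2 : ι) (hn : n q1 = n q2)
    (Ro Rcl : Equiv.Perm (Fin (n q2)) → Finset (List (TabCell n)))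
    (Q : QuadData s) : Prop :=
  Q.IsQuad ∧ ∃ ξ : Equiv.Perm (Fin (n q2)), Witness (T.tw q2 ξ) q1 q2 (Ro ξ) (Rcl ξ) Q

/-- Membership `τ ∈ S_{β,γ,b,c}`: `φ(T^τ_o) =t {{b_i with multiplicity β_i}}` and
`φ(T^τ_cl) =ct {{c_1^{λ_{11}},…,c_1^{λ_{1l_1}},…,c_q^{λ_{q1}},…,c_q^{λ_{ql_q}}}}` for
some positive integers `λ_{ij}` with `λ_{i1}+⋯+λ_{il_i} = γ_i`. -/
def SQuadMem (T : TabSub A ι n s) (q1 q2 : ι)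
    (Ro Rcl : Equiv.Perm (Fin (n q2)) → Finset (List (TabCell n)))
    (Q : QuadData s) (τ : Equiv.Perm (Fin (n q2))) : Prop :=
  Multiset.Rel weqT ((T.tw q2 τ).wordsOf (Ro τ)) Q.mB ∧
  ∃ L : Fin Q.q → Multiset ℕ,
    (∀ j, (∀ x ∈ L j, 0 < x) ∧ (L j).sum = Q.γ j) ∧
    Multiset.Rel weqCT ((T.tw q2 τ).wordsOf (Rcl τ))
      (∑ j, (L j).map fun lam => (List.replicate lam (Q.c j)).flatten)

/-- The set `S_τ` of permutations `π` with `φ(T^π_o) =t φ(T^τ_o)` and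
`φ(T^π_cl) =ct φ(T^τ_cl)`. -/
def SPerm (T : TabSub A ι n s) (q1 q2 : ι)
    (Ro Rcl : Equiv.Perm (Fin (n q2)) → Finset (List (TabCell n)))
    (τ : Equiv.Perm (Fin (n q2))) : Set (Equiv.Perm (Fin (n q2))) :=
  {π | Multiset.Rel weqT ((T.tw q2 π).wordsOf (Ro π)) ((T.tw q2 τ).wordsOf (Ro τ)) ∧
       Multiset.Rel weqCT ((T.tw q2 π).wordsOf (Rcl π)) ((T.tw q2 τ).wordsOf (Rcl τ))}

/-! ### Auxiliary constructions for Lemmas about `T^π` -/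

/-- The word of arrows of `T` underlying a word of arrows of `T^τ`. -/
def underlying (T : TabSub A ι n s) (q2 : ι) (τ : Equiv.Perm (Fin (n q2)))
    (l : List (TabCell n)) : List (TabCell n) :=
  l.map (colPerm n q2 τ).symm

/-- The cell number of a cell lying in column `q_1` or `q_2`, as an element of
`Fin (n q2)` (using `n q1 = n q2`). -/
def toQ2 {q1 q2 : ι} (hn : n q1 = n q2) (c : TabCell n) (h : c.1 = q1 ∨ c.1 = q2) :
    Fin (n q2) :=
  if h2 : c.1 = q2 then Fin.cast (congrArg n h2) c.2
  else Fin.cast ((congrArg n (h.resolve_right h2)).trans hn) c.2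

/-- The substitution `a → b, b → a` on oriented arrows (hence also `aᵗ → bᵗ, bᵗ → aᵗ`). -/
def swapSub (T : TabSub A ι n s) (a b : TabCell n) (c : TabCell n) : TabCell n :=
  if c = a then b else if c = b then a
  else if c = T.mate a then T.mate b else if c = T.mate b then T.mate a else c

end TabSub

/-- The condition on a permutation `π` appearing in the definition of the pfaffian:
`π(1) < π(3) < ⋯ < π(N−1)` and `π(2i−1) < π(2i)` (written 0-based). -/
def pfCond {N : ℕ} (π : Equiv.Perm (Fin N)) : Prop :=
  (∀ i : ℕ, ∀ h : 2 * i + 1 < N, π ⟨2 * i, by omega⟩ < π ⟨2 * i + 1, h⟩) ∧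
  (∀ i j : ℕ, ∀ _hij : i < j, ∀ h : 2 * j < N, π ⟨2 * i, by omega⟩ < π ⟨2 * j, h⟩)

/-- `∏_{i=1}^{N/2} x_{π(2i−1), π(2i)}` (written 0-based). -/
def pairProd {A : Type*} [CommRing A] {N : ℕ} (X : Matrix (Fin N) (Fin N) A)
    (π : Equiv.Perm (Fin N)) : A :=
  ∏ i ∈ Finset.range (N / 2),
    if h : 2 * i + 1 < N then X (π ⟨2 * i, by omega⟩) (π ⟨2 * i + 1, h⟩) else 0

open scoped Classical in
/-- The pfaffian of a (skew-symmetric) `N×N` matrix. -/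
noncomputable def pfaffian {A : Type*} [CommRing A] {N : ℕ} (X : Matrix (Fin N) (Fin N) A) : A :=
  ∑ π ∈ Finset.univ.filter pfCond, (Equiv.Perm.sign π : ℤ) • pairProd X π

/-- The generalized pfaffian `P(X) = pf(X − Xᵗ)` of an arbitrary `N×N` matrix. -/
noncomputable def genPf {A : Type*} [CommRing A] {N : ℕ} (X : Matrix (Fin N) (Fin N) A) : A :=
  pfaffian (X - X.transpose)

/-- The partial linearization `P_{k_1,…,k_s}(X_1,…,X_s)`: the coefficient of
`x_1^{k_1}⋯x_s^{k_s}` in `P(x_1 X_1 + ⋯ + x_s X_s)`. -/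
noncomputable def pfLin {A : Type*} [CommRing A] {N s : ℕ} (k : Fin s → ℕ)
    (M : Fin s → Matrix (Fin N) (Fin N) A) : A :=
  MvPolynomial.coeff (Finsupp.equivFunOnFinite.symm k)
    (genPf (Matrix.of fun i j =>
      ∑ r, (MvPolynomial.X r : MvPolynomial (Fin s) A) * MvPolynomial.C (M r i j)))

/-- `offset n p = n_1 + ⋯ + n_{p-1}`. -/
def offset {m : ℕ} (n : Fin m → ℕ) (p : Fin m) : ℕ :=
  ∑ i ∈ Finset.univ.filter (· < p), n i

/-- The block matrix `X^{p,q}`: the `(n_1+⋯+n_m)×(n_1+⋯+n_m)` matrix whose `(p,q)`-th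
block is `X` and whose other blocks are zero. -/
def blockEmb {A : Type*} [CommRing A] {m : ℕ} (n : Fin m → ℕ) (p q : Fin m)
    (X : Matrix (Fin (n p)) (Fin (n q)) A) :
    Matrix (Fin (∑ i, n i)) (Fin (∑ i, n i)) A :=
  Matrix.of fun r c =>
    if h : offset n p ≤ r.1 ∧ r.1 < offset n p + n p ∧
           offset n q ≤ c.1 ∧ c.1 < offset n q + n q then
      X ⟨r.1 - offset n p, by omega⟩ ⟨c.1 - offset n q, by omega⟩
    else 0

/-- Unique sorting permutation. -/
theorem exUnique_sort {α β : Type} [Fintype α] [DecidableEq α] [DecidableEq β]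
    (g g0 : α → β)
    (hc : ∀ j, (Finset.univ.filter fun a => g a = j).card
      = (Finset.univ.filter fun a => g0 a = j).card)
    (κ0 κ : α → ℕ) (h0 : ∀ a b, g0 a = g0 b → κ0 a = κ0 b → a = b)
    (hκ : Function.Injective κ) :
    ∃! σ : Equiv.Perm α, (∀ a, g (σ a) = g0 a) ∧
      ∀ a b, g0 a = g0 b → κ0 a < κ0 b → κ (σ a) < κ (σ b) := by
  classical
  have hne : ∃ τ : Equiv.Perm α, ∀ a, g (τ a) = g0 a := by
    have : ∀ j, Nonempty ({a // g0 a = j} ≃ {a // g a = j}) := by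
      intro j
      refine ⟨Fintype.equivOfCardEq ?_⟩
      rw [Fintype.card_subtype, Fintype.card_subtype, hc]
    exact ⟨Equiv.ofFiberEquiv (fun j => (this j).some), fun a => Equiv.ofFiberEquiv_map _ a⟩
  obtain ⟨τ, hτ⟩ := hne
  obtain ⟨σ, hσ, hmax⟩ := Finset.exists_max_image
    (Finset.univ.filter fun σ : Equiv.Perm α => ∀ a, g (σ a) = g0 a)
    (fun σ => ∑ a, (κ0 a : ℤ) * (κ (σ a) : ℤ)) ⟨τ, by simpa using hτ⟩
  simp only [Finset.mem_filter, Finset.mem_univ, true_and] at hσ hmax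
  have hσs : (∀ a, g (σ a) = g0 a) ∧
      ∀ a b, g0 a = g0 b → κ0 a < κ0 b → κ (σ a) < κ (σ b) := by
    refine ⟨hσ, ?_⟩
    intro a b hab hlt
    by_contra hcon
    have hab' : a ≠ b := by rintro rfl; omega
    have hne : κ (σ a) ≠ κ (σ b) := fun h => hab' (σ.injective (hκ h))
    have hgt : κ (σ b) < κ (σ a) := by omega
    have := hmax (σ * Equiv.swap a b) (by
      intro c
      simp only [Equiv.Perm.mul_apply, hσ]
      rw [Equiv.swap_apply_def]
      split_ifs with h1 h2
      · rw [h1, hab]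
      · rw [h2, hab]
      · rfl)
    have hsplit : ∀ f : α → ℤ, ∑ c, f c = f a + f b + ∑ c ∈ (Finset.univ.erase a).erase b, f c := by
      intro f
      rw [← Finset.add_sum_erase Finset.univ f (Finset.mem_univ a),
        ← Finset.add_sum_erase (Finset.univ.erase a) f (a := b) (by simp [hab'.symm])]
      ring
    rw [hsplit, hsplit] at this
    have he : ∑ c ∈ (Finset.univ.erase a).erase b,
        (κ0 c : ℤ) * (κ ((σ * Equiv.swap a b) c) : ℤ)
        = ∑ c ∈ (Finset.univ.erase a).erase b, (κ0 c : ℤ) * (κ (σ c) : ℤ) := by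
      refine Finset.sum_congr rfl fun c hcc => ?_
      simp only [Finset.mem_erase, Finset.mem_univ, and_true] at hcc
      rw [Equiv.Perm.mul_apply, Equiv.swap_apply_of_ne_of_ne hcc.2 hcc.1]
    rw [he] at this
    simp only [Equiv.Perm.mul_apply, Equiv.swap_apply_left, Equiv.swap_apply_right] at this
    zify at hlt hgt
    nlinarith
  refine ⟨σ, hσs, ?_⟩
  · -- uniqueness
    have key : ∀ ρ : Equiv.Perm α, ((∀ a, g (ρ a) = g0 a) ∧
      ∀ a b, g0 a = g0 b → κ0 a < κ0 b → κ (ρ a) < κ (ρ b)) → ∀ a,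
        (Finset.univ.filter fun c => g c = g0 a ∧ κ c < κ (ρ a)).card
         = (Finset.univ.filter fun b => g0 b = g0 a ∧ κ0 b < κ0 a).card := by
      rintro ρ ⟨h1, h2⟩ a
      symm
      refine Finset.card_bij (fun b _ => ρ b) ?_ (fun _ _ _ _ h => ρ.injective h) ?_
      · intro b hb
        simp only [Finset.mem_filter, Finset.mem_univ, true_and] at hb ⊢
        exact ⟨by rw [h1, hb.1], h2 _ _ hb.1 hb.2⟩
      · intro c hcc
        simp only [Finset.mem_filter, Finset.mem_univ, true_and] at hcc ⊢
        refine ⟨ρ.symm c, ?_, by simp⟩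
        have e1 : g0 (ρ.symm c) = g0 a := by rw [← h1]; simpa using hcc.1
        refine ⟨e1, ?_⟩
        rcases lt_trichotomy (κ0 (ρ.symm c)) (κ0 a) with h | h | h
        · exact h
        · have := h0 _ _ e1 h
          rw [← this] at hcc
          simp at hcc
        · have := h2 _ _ e1.symm h
          simp at this
          omega
    intro ρ hρ
    ext a
    have e := (key ρ hρ a).trans (key σ hσs a).symm
    rcases lt_trichotomy (κ (ρ a)) (κ (σ a)) with h | h | h
    · exfalso
      refine absurd e (ne_of_lt (Finset.card_lt_card ?_))
      rw [Finset.ssubset_iff_of_subset]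
      · exact ⟨ρ a, by simp [h, hρ.1], by simp⟩
      · intro c; simp only [Finset.mem_filter, Finset.mem_univ, true_and]; rintro ⟨u, v⟩; exact ⟨u, v.trans h⟩
    · exact hκ h
    · exfalso
      refine absurd e.symm (ne_of_lt (Finset.card_lt_card ?_))
      rw [Finset.ssubset_iff_of_subset]
      · exact ⟨σ a, by simp [h, hσ], by simp⟩
      · intro c; simp only [Finset.mem_filter, Finset.mem_univ, true_and]; rintro ⟨u, v⟩; exact ⟨u, v.trans h⟩

/-- Comparison of two transversals. -/
theorem transversal_sum {G S A : Type} [Group G] [Fintype G] [Fintype S] [CommRing A]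
    (act : G → Equiv.Perm S) (hinv : ∀ g x, act g (act g⁻¹ x) = x)
    (R1 R2 : S → Prop) [DecidablePred R1] [DecidablePred R2]
    (f : S → A) (hf : ∀ g x, f (act g x) = f x)
    (h1 : ∀ x, ∃! g, R1 (act g x))
    (h2 : ∀ x, f x ≠ 0 → ∃! g, R2 (act g x)) :
    ∑ x, (if R1 x then f x else 0) = ∑ x, (if R2 x then f x else 0) := by
  classical
  have aux : ∀ (R : S → Prop) [DecidablePred R] (x : S), (∃! g, R (act g x)) →
      ∑ g : G, (if R (act g x) then f x else 0) = f x := by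
    intro R _ x ⟨g, hg, hu⟩
    rw [Finset.sum_eq_single g]
    · simp [hg]
    · intro b _ hb
      rw [if_neg]
      exact fun h => hb (hu b h)
    · simp
  have aux2 : ∀ x, ∑ g : G, (if R2 (act g x) then f x else 0) = f x := by
    intro x
    by_cases hx : f x = 0
    · simp [hx]
    · exact aux R2 x (h2 x hx)
  calc ∑ x, (if R1 x then f x else 0)
      = ∑ x, ∑ g : G, (if R1 x then (if R2 (act g x) then f x else 0) else 0) := by
        refine Finset.sum_congr rfl fun x _ => ?_
        split_ifs
        · rw [aux2]
        · simp
    _ = ∑ g : G, ∑ x, (if R1 x then (if R2 (act g x) then f x else 0) else 0) :=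
        Finset.sum_comm
    _ = ∑ g : G, ∑ x, (if R1 (act g⁻¹ x) then (if R2 x then f x else 0) else 0) := by
        refine Finset.sum_congr rfl fun g _ => ?_
        rw [← Equiv.sum_comp (act g⁻¹)]
        refine Finset.sum_congr rfl fun x _ => ?_
        rw [hinv, hf]
    _ = ∑ x, ∑ g : G, (if R1 (act g⁻¹ x) then (if R2 x then f x else 0) else 0) :=
        Finset.sum_comm
    _ = _ := by
        refine Finset.sum_congr rfl fun x _ => ?_
        rw [← Equiv.sum_comp (Equiv.inv G)]
        simp only [Equiv.inv_apply, inv_inv]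
        split_ifs
        · exact aux R1 x (h1 x)
        · simp

theorem sign_sigmaCongrRight' {ι : Type} [Fintype ι] [DecidableEq ι] {n : ι → ℕ}
    (π : ∀ i, Equiv.Perm (Fin (n i))) :
    Equiv.Perm.sign (Equiv.sigmaCongrRight π : Equiv.Perm (Σ i, Fin (n i)))
      = ∏ i, Equiv.Perm.sign (π i) := by
  have : (Equiv.Perm.sign.comp (Equiv.Perm.sigmaCongrRightHom fun i => Fin (n i)))
      = ∏ i, (Equiv.Perm.sign.comp (Pi.evalMonoidHom _ i)) := by
    apply MonoidHom.pi_ext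
    intro i σ
    simp only [MonoidHom.comp_apply, MonoidHom.finsetProd_apply, Pi.evalMonoidHom_apply]
    rw [Finset.prod_eq_single i]
    · rw [Pi.mulSingle_eq_same]
      induction σ using Equiv.Perm.swap_induction_on with
      | one => simp
      | swap_mul f x y hxy ih =>
        rw [Pi.mulSingle_mul, map_mul, map_mul, map_mul, ih]
        congr 1
        rw [Equiv.Perm.sign_swap hxy]
        have : (Equiv.Perm.sigmaCongrRightHom fun i => Fin (n i)) (Pi.mulSingle i (Equiv.swap x y))
          = Equiv.swap ⟨i, x⟩ ⟨i, y⟩ := by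
          ext1 ⟨j, z⟩
          by_cases hj : j = i
          · subst hj
            simp only [Equiv.Perm.sigmaCongrRightHom_apply, Equiv.sigmaCongrRight_apply, Sigma.map,
              Pi.mulSingle_eq_same]
            simp only [Equiv.swap_apply_def]
            split_ifs <;> simp_all
          · simp [Equiv.Perm.sigmaCongrRight, Pi.mulSingle_eq_of_ne hj, Equiv.swap_apply_def, Sigma.map, hj]
        rw [this, Equiv.Perm.sign_swap]
        simpa using hxy
    · intro j _ hj
      rw [Pi.mulSingle_eq_of_ne hj]; simp
    · simp
  have h := DFunLike.congr_fun this π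
  simpa [MonoidHom.finsetProd_apply] using h

/-- Pairs-to-positions equivalence. -/
def qe {h N : ℕ} (hN : N = 2 * h) : Bool × Fin h ≃ Fin N where
  toFun p := ⟨2 * p.2.1 + p.1.toNat, by
    have := p.2.2
    have : p.1.toNat ≤ 1 := Bool.toNat_le p.1
    omega⟩
  invFun x := (decide (x.1 % 2 = 1), ⟨x.1 / 2, by omega⟩)
  left_inv := by
    rintro ⟨b, i⟩
    cases b <;> simp <;> ext <;> simp <;> omega
  right_inv := by
    rintro ⟨x, hx⟩
    rcases Nat.mod_two_eq_zero_or_one x with h | h <;> simp [h] <;> omega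

def KM {h N : ℕ} (q : Bool × Fin h ≃ Fin N) (w : Equiv.Perm (Bool × Fin h)) (i : Fin h) : ℕ :=
  min (q (w (false, i))).1 (q (w (true, i))).1

def CA {h N : ℕ} (q : Bool × Fin h ≃ Fin N) (w : Equiv.Perm (Bool × Fin h)) : Prop :=
  ∀ i, q (w (false, i)) < q (w (true, i))

def CB {h N : ℕ} (q : Bool × Fin h ≃ Fin N) (w : Equiv.Perm (Bool × Fin h)) : Prop :=
  ∀ i j, i < j → KM q w i < KM q w j

def WP {A : Type*} [CommRing A] {h N : ℕ} (q : Bool × Fin h ≃ Fin N)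
    (Y : Matrix (Fin N) (Fin N) A) (w : Equiv.Perm (Bool × Fin h)) : A :=
  ∏ i, Y (q (w (false, i))) (q (w (true, i)))

theorem pfaffian_eq {A : Type*} [CommRing A] {h N : ℕ} (hN : N = 2 * h)
    (Y : Matrix (Fin N) (Fin N) A) :
    pfaffian Y = ∑ w : Equiv.Perm (Bool × Fin h),
      if CA (qe hN) w ∧ CB (qe hN) w then (Equiv.Perm.sign w : ℤ) • WP (qe hN) Y w else 0 := by
  classical
  rw [pfaffian, Finset.sum_filter, ← Equiv.sum_comp (qe hN).permCongr]
  refine Finset.sum_congr rfl fun w _ => ?_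
  have e0 : ∀ (i : ℕ) (hi : i < h) (h' : 2 * i < N), (qe hN).permCongr w ⟨2 * i, h'⟩
      = qe hN (w (false, ⟨i, hi⟩)) := by
    intro i hi h'
    rw [Equiv.permCongr_apply]
    congr 2
    rw [Equiv.symm_apply_eq]
    simp [qe]
  have e1 : ∀ (i : ℕ) (hi : i < h) (h' : 2 * i + 1 < N), (qe hN).permCongr w ⟨2 * i + 1, h'⟩
      = qe hN (w (true, ⟨i, hi⟩)) := by
    intro i hi h'
    rw [Equiv.permCongr_apply]
    congr 2
    rw [Equiv.symm_apply_eq]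
    simp [qe]
  have hcond : pfCond ((qe hN).permCongr w) ↔ CA (qe hN) w ∧ CB (qe hN) w := by
    have hA : (∀ i : ℕ, ∀ h : 2 * i + 1 < N, (qe hN).permCongr w ⟨2 * i, by omega⟩
        < (qe hN).permCongr w ⟨2 * i + 1, h⟩) ↔ CA (qe hN) w := by
      constructor
      · intro H i
        have := H i.1 (by omega)
        rwa [e0 i.1 i.2, e1 i.1 i.2] at this
      · intro H i hi
        rw [e0 i (by omega), e1 i (by omega)]
        exact H _
    unfold pfCond
    rw [hA]
    refine and_congr_right fun hca => ?_
    have hK : ∀ i, KM (qe hN) w i = (qe hN (w (false, i))).1 := by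
      intro i
      exact min_eq_left (hca i).le
    unfold CB
    simp only [hK]
    constructor
    · intro H i j hij
      have := H i.1 j.1 hij (by omega)
      rwa [e0 i.1 i.2, e0 j.1 j.2] at this
    · intro H i j hij hj
      rw [e0 i (by omega), e0 j (by omega)]
      exact H _ _ hij
  rw [Equiv.Perm.sign_permCongr]
  by_cases hc : pfCond ((qe hN).permCongr w)
  · rw [if_pos hc, if_pos (hcond.1 hc)]
    congr 1
    unfold pairProd WP
    have : N / 2 = h := by omega
    rw [this, Finset.prod_range]
    refine Finset.prod_congr rfl fun i _ => ?_
    rw [dif_pos (by omega), e0 i.1 i.2, e1 i.1 i.2]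
  · rw [if_neg hc, if_neg (fun hh => hc (hcond.2 hh))]

/-- Flip of the pairs. -/
def flipP {h : ℕ} (t : Fin h → Equiv.Perm Bool) : Equiv.Perm (Bool × Fin h) :=
  Equiv.prodCongrLeft t

theorem permBool_univ : (Finset.univ : Finset (Equiv.Perm Bool)) = {1, Equiv.swap false true} := by
  decide

theorem permBool_cases (t : Equiv.Perm Bool) : t = 1 ∨ t = Equiv.swap false true := by
  have := Finset.mem_univ t
  rw [permBool_univ] at this
  simpa using this

theorem KM_flip {h N : ℕ} (q : Bool × Fin h ≃ Fin N) (w : Equiv.Perm (Bool × Fin h))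
    (t : Fin h → Equiv.Perm Bool) (i : Fin h) : KM q (w * flipP t) i = KM q w i := by
  simp only [KM, flipP, Equiv.Perm.mul_apply, Equiv.prodCongrLeft_apply]
  rcases permBool_cases (t i) with ht | ht <;> simp [ht, min_comm]

theorem CA_flip {h N : ℕ} (q : Bool × Fin h ≃ Fin N) (w : Equiv.Perm (Bool × Fin h)) :
    ∃! t : Fin h → Equiv.Perm Bool, CA q (w * flipP t) := by
  have h1 : ∀ i, ∃! t : Equiv.Perm Bool, q (w (t false, i)) < q (w (t true, i)) := by
    intro i
    have hne : q (w (false, i)) ≠ q (w (true, i)) := by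
      intro hh
      have := w.injective (q.injective hh)
      simp at this
    rcases lt_or_gt_of_ne hne with hl | hl
    · refine ⟨1, by simpa using hl, ?_⟩
      intro t ht
      rcases permBool_cases t with rfl | rfl
      · rfl
      · simp at ht
        exact absurd ht (lt_asymm hl)
    · refine ⟨Equiv.swap false true, by simpa using hl, ?_⟩
      intro t ht
      rcases permBool_cases t with rfl | rfl
      · simp at ht
        exact absurd ht (lt_asymm hl)
      · rfl
  choose t ht hu using h1
  refine ⟨t, fun i => by simpa [flipP] using ht i, ?_⟩
  intro t' ht'
  funext i
  exact hu i _ (by simpa [flipP] using ht' i)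

theorem genPf_eq {A : Type*} [CommRing A] {h N : ℕ} (hN : N = 2 * h)
    (Z : Matrix (Fin N) (Fin N) A) :
    genPf Z = ∑ w : Equiv.Perm (Bool × Fin h),
      if CB (qe hN) w then (Equiv.Perm.sign w : ℤ) • WP (qe hN) Z w else 0 := by
  classical
  rw [genPf, pfaffian_eq hN]
  set q := qe hN
  set F : Equiv.Perm (Bool × Fin h) → A := fun w => (Equiv.Perm.sign w : ℤ) • WP q Z w with hF
  have hexp : ∀ w, (Equiv.Perm.sign w : ℤ) • WP q (Z - Z.transpose) w
      = ∑ t : Fin h → Equiv.Perm Bool, F (w * flipP t) := by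
    intro w
    have : WP q (Z - Z.transpose) w = ∏ i, ∑ t : Equiv.Perm Bool,
        (Equiv.Perm.sign t : ℤ) • Z (q (w (t false, i))) (q (w (t true, i))) := by
      unfold WP
      refine Finset.prod_congr rfl fun i _ => ?_
      rw [permBool_univ, Finset.sum_pair (by decide)]
      simp [sub_eq_add_neg, Equiv.Perm.sign_swap]
    rw [this, Fintype.prod_sum, Finset.smul_sum]
    refine Finset.sum_congr rfl fun t _ => ?_
    simp only [hF, WP, flipP, Equiv.Perm.mul_apply, Equiv.prodCongrLeft_apply, map_mul,
      Equiv.Perm.sign_prodCongrLeft, zsmul_eq_mul, Finset.prod_mul_distrib]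
    push_cast
    ring
  have hcb : ∀ w t, CB q (w * flipP t) ↔ CB q w := by
    intro w t
    simp only [CB, KM_flip]
  have hfi : ∀ t : Fin h → Equiv.Perm Bool, ∀ w, w * flipP t⁻¹ * flipP t = w := by
    intro t w
    rw [mul_assoc]
    have : (flipP t⁻¹ * flipP t : Equiv.Perm (Bool × Fin h)) = 1 := by
      ext1 ⟨b, i⟩
      simp [flipP]
    rw [this, mul_one]
  calc _ = ∑ w, ∑ t : Fin h → Equiv.Perm Bool,
          (if CA q w ∧ CB q w then F (w * flipP t) else 0) := by
        refine Finset.sum_congr rfl fun w _ => ?_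
        split_ifs
        · rw [hexp]
        · simp
    _ = ∑ t : Fin h → Equiv.Perm Bool, ∑ w,
          (if CA q w ∧ CB q w then F (w * flipP t) else 0) := Finset.sum_comm
    _ = ∑ t : Fin h → Equiv.Perm Bool, ∑ w,
          (if CA q (w * flipP t⁻¹) ∧ CB q w then F w else 0) := by
        refine Finset.sum_congr rfl fun t _ => ?_
        rw [← Equiv.sum_comp (Equiv.mulRight (flipP t⁻¹))]
        refine Finset.sum_congr rfl fun w _ => ?_
        simp only [Equiv.coe_mulRight, hfi, hcb]
    _ = ∑ w, ∑ t : Fin h → Equiv.Perm Bool,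
          (if CA q (w * flipP t⁻¹) ∧ CB q w then F w else 0) := Finset.sum_comm
    _ = _ := by
        refine Finset.sum_congr rfl fun w _ => ?_
        rw [← Equiv.sum_comp (Equiv.inv (Fin h → Equiv.Perm Bool))]
        simp only [Equiv.inv_apply, inv_inv]
        by_cases hc : CB q w
        · simp only [hc, and_true, if_true]
          obtain ⟨t, ht, hu⟩ := CA_flip q w
          rw [Finset.sum_eq_single t]
          · rw [if_pos ht]
          · intro b _ hb
            rw [if_neg]
            exact fun h => hb (hu b h)
          · simp
        · simp [hc]

theorem pfLin_eq {A : Type} [CommRing A] {h N s : ℕ} (hN : N = 2 * h) (k : Fin s → ℕ)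
    (M : Fin s → Matrix (Fin N) (Fin N) A) :
    pfLin k M = ∑ x : Equiv.Perm (Bool × Fin h) × (Fin h → Fin s),
      if CB (qe hN) x.1 then
        (if ∀ j, (Finset.univ.filter fun i => x.2 i = j).card = k j then
          (Equiv.Perm.sign x.1 : ℤ) •
            ∏ i, M (x.2 i) (qe hN (x.1 (false, i))) (qe hN (x.1 (true, i))) else 0) else 0 := by
  classical
  rw [pfLin, genPf_eq hN, MvPolynomial.coeff_sum, Fintype.sum_prod_type]
  refine Finset.sum_congr rfl fun w _ => ?_
  split_ifs with hc
  · rw [MvPolynomial.coeff_smul, WP]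
    simp only [Matrix.of_apply]
    rw [Fintype.prod_sum, MvPolynomial.coeff_sum, Finset.smul_sum]
    refine Finset.sum_congr rfl fun g _ => ?_
    rw [Finset.prod_mul_distrib]
    have h1 : (∏ i : Fin h, (MvPolynomial.X (g i) : MvPolynomial (Fin s) A))
        = MvPolynomial.monomial (∑ i, Finsupp.single (g i) 1) 1 := by
      rw [MvPolynomial.monomial_sum_one]; rfl
    rw [h1, ← map_prod, mul_comm, MvPolynomial.coeff_C_mul, MvPolynomial.coeff_monomial]
    have h2 : (∑ i, Finsupp.single (g i) 1 = Finsupp.equivFunOnFinite.symm k) ↔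
        ∀ j, (Finset.univ.filter fun i => g i = j).card = k j := by
      rw [Finsupp.ext_iff]
      refine forall_congr' fun j => ?_
      rw [Finsupp.finsetSum_apply, Finset.card_filter]
      simp only [Finsupp.single_apply]
      rfl
    by_cases h3 : ∀ j, (Finset.univ.filter fun i => g i = j).card = k j
    · rw [if_pos (h2.2 h3), if_pos h3, mul_one]
    · rw [if_neg (fun hh => h3 (h2.1 hh)), if_neg h3]; simp
  · simp

def liftP {h : ℕ} (σ : Equiv.Perm (Fin h)) : Equiv.Perm (Bool × Fin h) :=
  Equiv.prodCongrRight fun _ => σ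

theorem liftP_inv1 {h : ℕ} (σ : Equiv.Perm (Fin h)) : liftP σ * liftP σ⁻¹ = 1 := by
  ext1 ⟨b, i⟩
  simp [liftP]

theorem liftP_inv2 {h : ℕ} (σ : Equiv.Perm (Fin h)) : liftP σ⁻¹ * liftP σ = 1 := by
  ext1 ⟨b, i⟩
  simp [liftP]

theorem pfLin_eq2 {A : Type} [CommRing A] {h N s : ℕ} (hN : N = 2 * h) (k : Fin s → ℕ)
    (M : Fin s → Matrix (Fin N) (Fin N) A) (g0 : Fin h → Fin s) (κ0 : Fin h → ℕ)
    (hg0 : ∀ j, (Finset.univ.filter fun i => g0 i = j).card = k j)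
    (h0 : ∀ a b, g0 a = g0 b → κ0 a = κ0 b → a = b) :
    pfLin k M = ∑ w : Equiv.Perm (Bool × Fin h),
      if (∀ i j, g0 i = g0 j → κ0 i < κ0 j →
          (qe hN (w (false, i))).1 < (qe hN (w (false, j))).1) then
        (Equiv.Perm.sign w : ℤ) •
            ∏ i, M (g0 i) (qe hN (w (false, i))) (qe hN (w (true, i))) else 0 := by
  classical
  rw [pfLin_eq hN]
  set q := qe hN
  let act : Equiv.Perm (Fin h) →
      Equiv.Perm (Equiv.Perm (Bool × Fin h) × (Fin h → Fin s)) := fun σ =>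
    { toFun := fun x => (x.1 * liftP σ, x.2 ∘ σ)
      invFun := fun x => (x.1 * liftP σ⁻¹, x.2 ∘ ⇑(σ⁻¹))
      left_inv := by
        rintro ⟨w, g⟩
        refine Prod.ext ?_ ?_
        · simp [mul_assoc, liftP_inv1]
        · ext; simp
      right_inv := by
        rintro ⟨w, g⟩
        refine Prod.ext ?_ ?_
        · simp [mul_assoc, liftP_inv2]
        · ext; simp }
  have hact : ∀ σ x, act σ x = (x.1 * liftP σ, x.2 ∘ σ) := fun _ _ => rfl
  have hT := transversal_sum (A := A) act
    (by
      rintro σ ⟨w, g⟩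
      simp only [hact]
      refine Prod.ext ?_ ?_
      · simp [mul_assoc, liftP_inv2]
      · ext; simp)
    (fun x => CB q x.1)
    (fun x => x.2 = g0 ∧ ∀ i j, g0 i = g0 j → κ0 i < κ0 j →
          (q (x.1 (false, i))).1 < (q (x.1 (false, j))).1)
    (fun x => if ∀ j, (Finset.univ.filter fun i => x.2 i = j).card = k j then
          (Equiv.Perm.sign x.1 : ℤ) •
            ∏ i, M (x.2 i) (q (x.1 (false, i))) (q (x.1 (true, i))) else 0)
    ?_ ?_ ?_
  · refine Eq.trans ?_ (hT.trans ?_)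
    · refine Finset.sum_congr rfl fun x _ => ?_
      congr
    · rw [Fintype.sum_prod_type]
      refine Finset.sum_congr rfl fun w _ => ?_
      rw [Finset.sum_eq_single g0]
      · simp only [true_and, hg0, implies_true, if_true]
      · intro b _ hb
        simp [hb]
      · simp
  · rintro σ ⟨w, g⟩
    simp only [hact]
    have hcnt : ∀ j, (Finset.univ.filter fun i => (g ∘ σ) i = j).card
        = (Finset.univ.filter fun i => g i = j).card := by
      intro j
      refine Finset.card_bij (fun i _ => σ i) ?_ (fun _ _ _ _ hh => σ.injective hh) ?_
      · intro a ha; simpa using ha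
      · intro b hb; exact ⟨σ.symm b, by simpa using hb, by simp⟩
    simp only [hcnt]
    have hs : Equiv.Perm.sign (w * liftP σ) = Equiv.Perm.sign w := by
      rw [map_mul, liftP, Equiv.Perm.sign_prodCongrRight]
      simp
    rw [hs]
    have hp : ∏ i, M ((g ∘ σ) i) (q ((w * liftP σ) (false, i))) (q ((w * liftP σ) (true, i)))
        = ∏ i, M (g i) (q (w (false, i))) (q (w (true, i))) := by
      exact Equiv.prod_comp σ (fun i => M (g i) (q (w (false, i))) (q (w (true, i))))
    rw [hp]
  · rintro ⟨w, g⟩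
    have hinj : Function.Injective (KM q w) := by
      intro i j hij
      simp only [KM] at hij
      have key : ∃ b b', q (w (b, i)) = q (w (b', j)) := by
        rcases min_choice (q (w (false, i))).1 (q (w (true, i))).1 with h1 | h1 <;>
        rcases min_choice (q (w (false, j))).1 (q (w (true, j))).1 with h2 | h2 <;>
        rw [h1, h2] at hij <;> exact ⟨_, _, Fin.ext hij⟩
      obtain ⟨b, b', hb⟩ := key
      have := w.injective (q.injective hb)
      simpa using congrArg Prod.snd this
    have := exUnique_sort (fun _ : Fin h => ()) (fun _ => ()) (fun _ => rfl) (fun i => i.1)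
      (KM q w) (fun a b _ hab => Fin.ext hab) hinj
    simpa [CB, hact, KM, liftP] using this
  · rintro ⟨w, g⟩ hx
    have hcnt : ∀ j, (Finset.univ.filter fun i => g i = j).card = k j := by
      by_contra hcon
      exact hx (if_neg hcon)
    have := exUnique_sort g g0 (fun j => by rw [hcnt, hg0]) κ0
      (fun i => (q (w (false, i))).1) h0 (by
        intro i j hij
        have := w.injective (q.injective (Fin.ext hij))
        simpa using congrArg Prod.snd this)
    simpa [hact, liftP, funext_iff] using this

theorem eCell_val {m : ℕ} {n : Fin m → ℕ} (c : TabCell n) :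
    (finSigmaFinEquiv c : ℕ) = offset n c.1 + c.2.1 := by
  rw [finSigmaFinEquiv_apply, offset]
  congr 1
  refine Finset.sum_bij (fun i _ => Fin.castLE c.1.2.le i) ?_ ?_ ?_ ?_
  · intro a _
    simp only [Finset.mem_filter, Finset.mem_univ, true_and]
    exact a.2
  · intro a _ b _ hab
    simpa using hab
  · intro b hb
    simp only [Finset.mem_filter, Finset.mem_univ, true_and] at hb
    exact ⟨⟨b.1, hb⟩, by simp, rfl⟩
  · intros; rfl

theorem eCell_range {m : ℕ} {n : Fin m → ℕ} (c : TabCell n) (p : Fin m) :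
    (offset n p ≤ (finSigmaFinEquiv c : ℕ) ∧ (finSigmaFinEquiv c : ℕ) < offset n p + n p)
      ↔ c.1 = p := by
  constructor
  · rintro ⟨h1, h2⟩
    have : finSigmaFinEquiv c
        = finSigmaFinEquiv (⟨p, ⟨(finSigmaFinEquiv c : ℕ) - offset n p, by omega⟩⟩ : TabCell n) := by
      apply Fin.ext
      rw [eCell_val (⟨p, _⟩ : TabCell n)]
      simp only
      omega
    have := finSigmaFinEquiv.injective this
    rw [this]
  · rintro rfl
    rw [eCell_val]
    omega

theorem blockEmb_apply {A : Type} [CommRing A] {m : ℕ} (n : Fin m → ℕ) (p q : Fin m)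
    (X : Matrix (Fin (n p)) (Fin (n q)) A) (c d : TabCell n) :
    blockEmb n p q X (finSigmaFinEquiv c) (finSigmaFinEquiv d)
      = if c.1 = p ∧ d.1 = q then TabSub.castEntry X c.2.1 d.2.1 else 0 := by
  rw [blockEmb, Matrix.of_apply]
  by_cases h : c.1 = p ∧ d.1 = q
  · rw [if_pos h, dif_pos (by
      rw [← and_assoc, eCell_range, eCell_range]; exact h)]
    obtain ⟨rfl, rfl⟩ := h
    rw [TabSub.castEntry, dif_pos ⟨c.2.2, d.2.2⟩]
    congr 1 <;> apply Fin.ext <;> simp only [eCell_val] <;> omega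
  · rw [if_neg h, dif_neg]
    rw [← and_assoc, eCell_range, eCell_range]; exact h

namespace TabSub

variable {A : Type} [CommRing A] {m s : ℕ} {n : Fin m → ℕ}

/-- Cells as (head or tail, arrow). -/
def betaE (T : TabSub A (Fin m) n s) : Bool × {c : TabCell n // T.isTail c = true} ≃ TabCell n where
  toFun p := if p.1 then T.mate p.2.1 else p.2.1
  invFun c := if h : T.isTail c = true then (false, ⟨c, h⟩)
    else (true, ⟨T.mate c, by rw [T.isTail_mate]; simpa using h⟩)
  left_inv := by
    rintro ⟨b, c, hc⟩
    cases b
    · simp [hc]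
    · have : T.isTail (T.mate c) = false := by rw [T.isTail_mate, hc]; rfl
      simp [this, T.mate_invol]
  right_inv := by
    intro c
    by_cases h : T.isTail c = true
    · simp [h]
    · simp [h, T.mate_invol]

theorem main_aux (T : TabSub A (Fin m) n s)
    (k : Fin s → ℕ) (hk : ∀ j, k j = (T.tails.filter fun c => T.lab c = j).card) :
    ∃ u : ℤˣ, pfLin k (fun j => blockEmb n (T.colTail j) (T.colHead j) (T.X j)) = (u : ℤ) • T.bpf := by
  classical
  obtain ⟨h, hh⟩ : ∃ h, h = Fintype.card {c : TabCell n // T.isTail c = true} := ⟨_, rfl⟩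
  let θ : Fin h ≃ {c : TabCell n // T.isTail c = true} := (Fintype.equivFinOfCardEq hh.symm).symm
  have hN : ∑ i, n i = 2 * h := by
    have := Fintype.card_congr T.betaE
    simp only [Fintype.card_prod, Fintype.card_bool, ← hh, Fintype.card_sigma,
      Fintype.card_fin] at this
    exact this.symm
  let β : Bool × Fin h ≃ TabCell n := (Equiv.prodCongrRight fun _ => θ).trans T.betaE
  have hβf : ∀ i, β (false, i) = (θ i).1 := fun i => rfl
  have hβt : ∀ i, β (true, i) = T.mate (θ i).1 := fun i => rfl
  let g0 : Fin h → Fin s := fun i => T.lab (θ i).1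
  let κ0 : Fin h → ℕ := fun i => (θ i).1.2.1
  have hcol : ∀ a b, g0 a = g0 b → (θ a).1.1 = (θ b).1.1 := by
    intro a b hab
    rw [← T.colTail_eq _ (θ a).2, ← T.colTail_eq _ (θ b).2]
    exact congrArg _ hab
  have cext : ∀ c d : TabCell n, c.1 = d.1 → c.2.1 = d.2.1 → c = d := by
    rintro ⟨i, x⟩ ⟨j, y⟩ h1 h2
    change i = j at h1
    subst h1
    simpa [Fin.ext_iff] using h2
  have h0 : ∀ a b, g0 a = g0 b → κ0 a = κ0 b → a = b := by
    intro a b hab hκ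
    exact θ.injective (Subtype.ext (cext _ _ (hcol a b hab) hκ))
  have hg0 : ∀ j, (Finset.univ.filter fun i => g0 i = j).card = k j := by
    intro j
    rw [hk]
    refine Finset.card_bij (fun i _ => (θ i).1) ?_ ?_ ?_
    · intro a ha
      have := (θ a).2
      simp only [Finset.mem_filter, Finset.mem_univ, true_and, tails] at ha ⊢
      exact ⟨this, ha⟩
    · intro a _ b _ hab
      exact θ.injective (Subtype.ext hab)
    · intro c hc
      simp only [Finset.mem_filter, Finset.mem_univ, true_and, tails] at hc
      refine ⟨θ.symm ⟨c, hc.1⟩, ?_, by simp⟩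
      simp [g0, hc.2]
  let e : TabCell n ≃ Fin (∑ i, n i) := finSigmaFinEquiv
  let u : Equiv.Perm (Bool × Fin h) := (β.trans e).trans (qe hN).symm
  let wπ : (∀ i, Equiv.Perm (Fin (n i))) → Equiv.Perm (Bool × Fin h) := fun π =>
    u * β.symm.permCongr (Equiv.sigmaCongrRight π)
  have hw : ∀ π p, qe hN (wπ π p) = e ⟨(β p).1, π (β p).1 (β p).2⟩ := by
    intro π p
    simp [wπ, u, Equiv.permCongr_apply]
  refine ⟨Equiv.Perm.sign u, ?_⟩
  rw [pfLin_eq2 hN k _ g0 κ0 hg0 h0, bpf, Finset.sum_filter, Finset.smul_sum]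
  symm
  refine Finset.sum_of_injOn wπ ?_ (by simp) ?_ ?_
  · intro π _ π' _ hππ
    funext i
    ext1 x
    obtain ⟨p, hp⟩ := β.surjective ⟨i, x⟩
    have h1 := hw π p
    rw [hππ, hw] at h1
    have h2 := e.injective h1
    rw [hp] at h2
    simpa using h2.symm
  · intro w _ hw'
    by_contra hne
    apply hw'
    have hprod : ∏ i, blockEmb n (T.colTail (g0 i)) (T.colHead (g0 i)) (T.X (g0 i))
        (qe hN (w (false, i))) (qe hN (w (true, i))) ≠ 0 := by
      intro h0
      apply hne
      rw [h0]
      simp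
    have hfac : ∀ p, (e.symm (qe hN (w p))).1 = (β p).1 := by
      rintro ⟨b, i⟩
      have hi : blockEmb n (T.colTail (g0 i)) (T.colHead (g0 i)) (T.X (g0 i))
        (qe hN (w (false, i))) (qe hN (w (true, i))) ≠ 0 :=
        fun h0 => hprod (Finset.prod_eq_zero (Finset.mem_univ i) h0)
      rw [← e.apply_symm_apply (qe hN (w (false, i))),
        ← e.apply_symm_apply (qe hN (w (true, i)))] at hi
      rw [blockEmb_apply] at hi
      have hi2 : (e.symm (qe hN (w (false, i)))).1 = T.colTail (g0 i) ∧ (e.symm (qe hN (w (true, i)))).1 = T.colHead (g0 i) := by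
        by_contra hcon
        exact hi (if_neg hcon)
      cases b
      · rw [hi2.1, hβf]; exact T.colTail_eq _ (θ i).2
      · rw [hi2.2, hβt]; exact T.colHead_eq _ (θ i).2
    have hex : ∀ i (x : Fin (n i)), ∃ y : Fin (n i),
        (⟨i, y⟩ : TabCell n) = e.symm (qe hN (w (β.symm ⟨i, x⟩))) := by
      intro i x
      have := hfac (β.symm ⟨i, x⟩)
      rw [Equiv.apply_symm_apply] at this
      generalize e.symm (qe hN (w (β.symm ⟨i, x⟩))) = c at this
      obtain ⟨j, y⟩ := c
      simp only at this
      subst this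
      exact ⟨y, rfl⟩
    choose f hf using hex
    have hfi : ∀ i, Function.Injective (f i) := by
      intro i x y hxy
      have h1 := hf i x
      rw [hxy, hf i y] at h1
      have h2 := β.symm.injective (w.injective ((qe hN).injective (e.symm.injective h1)))
      simpa using h2.symm
    refine ⟨fun i => Equiv.ofBijective (f i) (Finite.injective_iff_bijective.1 (hfi i)), by simp, ?_⟩
    ext1 p
    apply (qe hN).injective
    rw [hw]
    simp only [Equiv.ofBijective_apply]
    rw [hf]
    simp
  · intro π _
    have hcond : T.SortedPi π ↔ ∀ i j, g0 i = g0 j → κ0 i < κ0 j →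
        (qe hN (wπ π (false, i))).1 < (qe hN (wπ π (false, j))).1 := by
      have hval : ∀ i, (qe hN (wπ π (false, i))).1
          = offset n (θ i).1.1 + (π (θ i).1.1 (θ i).1.2).1 := by
        intro i
        rw [hw]
        exact eCell_val _
      simp only [hval]
      constructor
      · intro H i j hij hlt
        have := H (θ i).1 (by simpa [tails] using (θ i).2) (θ j).1 (by simpa [tails] using (θ j).2)
          hij hlt
        have h3 := congrArg (offset n) (hcol i j hij)
        omega
      · intro H c hc d hd hl hlt
        have hc' : T.isTail c = true := by simpa [tails] using hc
        have hd' : T.isTail d = true := by simpa [tails] using hd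
        obtain ⟨i, hi⟩ := θ.surjective ⟨c, hc'⟩
        obtain ⟨j, hj⟩ := θ.surjective ⟨d, hd'⟩
        have hi' : (θ i).1 = c := by rw [hi]
        have hj' : (θ j).1 = d := by rw [hj]
        have := H i j (by simpa [g0, hi', hj'] using hl)
          (by simp only [κ0]; rw [hi', hj']; exact hlt)
        rw [hi', hj'] at this
        have hcd : c.1 = d.1 := by
          rw [← T.colTail_eq _ hc', ← T.colTail_eq _ hd', hl]
        have h3 := congrArg (offset n) hcd
        omega
    by_cases hS : T.SortedPi π
    · rw [if_pos hS, if_pos (hcond.1 hS)]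
      have hsgn : (Equiv.Perm.sign (wπ π) : ℤ) = (Equiv.Perm.sign u : ℤ) * sgnT π := by
        simp only [wπ, map_mul, Equiv.Perm.sign_permCongr, sign_sigmaCongrRight', sgnT]
        push_cast
        rfl
      rw [hsgn, mul_smul]
      congr 2
      have hmem : ∀ c, c ∈ T.tails ↔ T.isTail c = true := by intro c; simp [tails]
      rw [Finset.prod_subtype T.tails hmem, ← Equiv.prod_comp θ]
      refine Finset.prod_congr rfl fun i _ => ?_
      rw [hw, hw]
      simp only [e]
      rw [blockEmb_apply, if_pos]
      · rfl
      · exact ⟨(T.colTail_eq _ (θ i).2).symm, (T.colHead_eq _ (θ i).2).symm⟩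
    · rw [if_neg hS, if_neg (fun hh => hS (hcond.2 hh)), smul_zero]

theorem col_aux (T : TabSub A (Fin m) n s)
    (k : Fin s → ℕ) (hk : ∀ j, k j = (T.tails.filter fun c => T.lab c = j).card) (i : Fin m) :
      (∑ j ∈ Finset.univ.filter fun j => T.colTail j = i, k j) +
      (∑ j ∈ Finset.univ.filter fun j => T.colHead j = i, k j) = n i := by
  classical
  have hgen : ∀ f : Fin s → Fin m, (∑ j ∈ Finset.univ.filter fun j => f j = i, k j)
      = (T.tails.filter fun c => f (T.lab c) = i).card := by
    intro f
    rw [Finset.card_eq_sum_card_fiberwise (f := T.lab)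
      (t := Finset.univ.filter fun j => f j = i) (by intro c hc; simp at hc ⊢; exact hc.2)]
    refine Finset.sum_congr rfl fun j hj => ?_
    rw [hk, Finset.filter_filter]
    congr 1
    ext c
    simp only [Finset.mem_filter, Finset.mem_univ, true_and] at hj ⊢
    constructor
    · rintro ⟨h1, h2⟩; exact ⟨h1, by rw [h2, hj], h2⟩
    · rintro ⟨h1, _, h2⟩; exact ⟨h1, h2⟩
  rw [hgen T.colTail, hgen T.colHead]
  have h1 : (T.tails.filter fun c => T.colTail (T.lab c) = i)
      = (Finset.univ.filter fun c : TabCell n => c.1 = i).filter (fun c => T.isTail c = true) := by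
    ext c
    simp only [tails, Finset.mem_filter, Finset.mem_univ, true_and]
    constructor
    · rintro ⟨a, b⟩; exact ⟨by rw [← T.colTail_eq c a, b], a⟩
    · rintro ⟨a, b⟩; exact ⟨b, by rw [T.colTail_eq c b, a]⟩
  have h2 : (T.tails.filter fun c => T.colHead (T.lab c) = i).card
      = ((Finset.univ.filter fun c : TabCell n => c.1 = i).filter
          (fun c => ¬ T.isTail c = true)).card := by
    refine Finset.card_bij (fun c _ => T.mate c) ?_ (fun _ _ _ _ hh => T.mate.injective hh) ?_
    · intro c hc
      simp only [tails, Finset.mem_filter, Finset.mem_univ, true_and] at hc ⊢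
      exact ⟨by rw [← T.colHead_eq c hc.1, hc.2], by rw [T.isTail_mate, hc.1]; simp⟩
    · intro c hc
      simp only [tails, Finset.mem_filter, Finset.mem_univ, true_and] at hc ⊢
      have ht : T.isTail (T.mate c) = true := by rw [T.isTail_mate]; simpa using hc.2
      exact ⟨T.mate c, ⟨ht, by rw [T.colHead_eq _ ht, T.mate_invol, hc.1]⟩, T.mate_invol c⟩
  rw [h1, h2, Finset.card_filter_add_card_filter_not]
  have : (Finset.univ.filter fun c : TabCell n => c.1 = i)
      = (Finset.univ : Finset (Fin (n i))).map (Function.Embedding.sigmaMk i) := by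
    ext ⟨j, x⟩
    simp only [Finset.mem_filter, Finset.mem_univ, true_and, Finset.mem_map,
      Function.Embedding.sigmaMk_apply]
    constructor
    · rintro rfl; exact ⟨x, rfl⟩
    · rintro ⟨y, hy⟩; exact (congrArg Sigma.fst hy).symm
  rw [this]
  simp

end TabSub

open TabSub in
/-- Every tableau with substitution computes, up to sign, a block partial linearization
of the pfaffian satisfying the column condition. -/
theorem stmt11 (K : Type) [Field K] [Infinite K] (A : Type) [CommRing A] [Algebra K A]
    (m s : ℕ) (n : Fin m → ℕ) (hEven : Even (∑ i, n i))
    (T : TabSub A (Fin m) n s)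
    (k : Fin s → ℕ) (hk : ∀ j, k j = (T.tails.filter fun c => T.lab c = j).card) :
    (T.bpf = pfLin k
        (fun j => blockEmb n (T.colTail j) (T.colHead j) (T.X j)) ∨
     T.bpf = -pfLin k
        (fun j => blockEmb n (T.colTail j) (T.colHead j) (T.X j))) ∧
    ∀ i : Fin m,
      (∑ j ∈ Finset.univ.filter fun j => T.colTail j = i, k j) +
      (∑ j ∈ Finset.univ.filter fun j => T.colHead j = i, k j) = n i := by
  refine ⟨?_, fun i => ?_⟩
  · obtain ⟨u, hu⟩ := T.main_aux k hk
    rcases Int.units_eq_one_or u with rfl | rfl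
    · left; rw [hu]; simp
    · right; rw [hu]; simp
  · convert T.col_aux k hk i
end

section
/- Let (T,(X_1,…,X_s)) be a tableau with substitution of dimension n = (n_1,…,n_m) ∈ ℕ^m over a commutative unital ring, and let 1 ≤ q_1 < q_2 ≤ m with n_{q_1} = n_{q_2} = n. Then bpf⁰_T(X_1,…,X_s) = Σ_{τ ∈ S_n} sgn(τ) · bpf⁰_{T̃^τ}(X_{T̃^τ}) · tr(T^τ_cl), where tr(T^τ_cl) = ∏_{a ∈ T^τ_cl} tr(X_{φ(a)}). -/
open scoped BigOperators
set_option linter.unusedVariables false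

attribute [local instance] Classical.propDecidable

namespace TabAux

/-- The combinatorial hypotheses: `mt` pairs the cells, `p` pairs the cells satisfying `Q`. -/
structure Inv {α : Type} (mt p : α → α) (Q : α → Prop) (S : α → α → Prop) : Prop where
  mt_mt : ∀ c, mt (mt c) = c
  mt_ne : ∀ c, mt c ≠ c
  p_p : ∀ c, p (p c) = c
  Qp : ∀ c, Q (p c) ↔ Q c
  p_ne : ∀ c, Q c → p c ≠ c
  hS : ∀ c d, S c d ↔ Q (mt c) ∧ d = p (mt c)

/-- Open paths. -/
def OP {α : Type} (mt : α → α) (Q : α → Prop) (S : α → α → Prop) (l : List α) : Prop :=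
  (l ≠ [] ∧ l.IsChain S ∧ l.Nodup) ∧ 2 ≤ l.length ∧ ∀ h : l ≠ [],
    ¬ Q (l.head h) ∧ ¬ Q (mt (l.getLast h))

/-- Closed paths. -/
def CP {α : Type} (S : α → α → Prop) (l : List α) : Prop :=
  (l ≠ [] ∧ l.IsChain S ∧ l.Nodup) ∧ ∀ h : l ≠ [], S (l.getLast h) (l.head h)

/-- Transposed path. -/
def tpA {α : Type} (mt : α → α) (l : List α) : List α := (l.map mt).reverse

section
variable {α : Type} {mt p : α → α} {Q : α → Prop} {S : α → α → Prop}

theorem Inv.nx_inj (H : Inv mt p Q S) : Function.Injective (fun c => p (mt c)) := by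
  intro a b h
  have h1 : p (p (mt a)) = p (p (mt b)) := congrArg p h
  rw [H.p_p, H.p_p] at h1
  rw [← H.mt_mt a, h1, H.mt_mt]

theorem Inv.flip (H : Inv mt p Q S) (e : ℕ) (d : α) :
    (fun c => p (mt c))^[e] (mt ((fun c => p (mt c))^[e] d)) = mt d := by
  induction e generalizing d with
  | zero => rfl
  | succ e ih =>
    rw [Function.iterate_succ_apply', Function.iterate_succ_apply, ih]
    simp only [H.mt_mt, H.p_p]

theorem Inv.flip' (H : Inv mt p Q S) (e r : ℕ) (her : e ≤ r) (d : α) :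
    (fun c => p (mt c))^[e] (mt ((fun c => p (mt c))^[r] d)) =
      mt ((fun c => p (mt c))^[r - e] d) := by
  obtain ⟨k, rfl⟩ := Nat.exists_eq_add_of_le her
  rw [Function.iterate_add_apply, H.flip]
  simp

theorem Inv.chain (H : Inv mt p Q S) (c : α) (l : List α) :
    (c :: l).IsChain S ↔ (c :: l = List.iterate (fun c => p (mt c)) c (l.length + 1) ∧
      ∀ i < l.length, Q (mt ((fun c => p (mt c))^[i] c))) := by
  induction l generalizing c with
  | nil => simp [List.iterate]
  | cons d l ih =>
    rw [List.isChain_cons_cons, ih, H.hS]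
    constructor
    · rintro ⟨⟨h1, rfl⟩, h2, h3⟩
      refine ⟨?_, ?_⟩
      · rw [List.length_cons, List.iterate, ← h2]
      · intro i hi
        cases i with
        | zero => exact h1
        | succ i =>
          rw [Function.iterate_succ_apply]
          exact h3 i (by simpa using hi)
    · rintro ⟨h1, h2⟩
      have h0 := h2 0 (by simp)
      rw [List.length_cons, List.iterate, List.cons.injEq] at h1
      have hd : d = p (mt c) := by
        have := h1.2
        rw [List.iterate, List.cons.injEq] at this
        exact this.1
      subst hd
      refine ⟨⟨h0, rfl⟩, h1.2, ?_⟩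
      intro i hi
      have := h2 (i+1) (by simpa using hi)
      rwa [Function.iterate_succ_apply] at this

theorem Inv.op_form (H : Inv mt p Q S) {l : List α} (hl : OP mt Q S l) :
    ∃ c r, 1 ≤ r ∧ l = List.iterate (fun c => p (mt c)) c (r + 1) ∧ ¬ Q c ∧
      (∀ i < r, Q (mt ((fun c => p (mt c))^[i] c))) ∧
      ¬ Q (mt ((fun c => p (mt c))^[r] c)) := by
  obtain ⟨⟨hne, hch, hnd⟩, h2, h3⟩ := hl
  cases l with
  | nil => exact absurd rfl hne
  | cons c l =>
    obtain ⟨h4, h5⟩ := (H.chain c l).1 hch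
    have h3 := h3 hne
    refine ⟨c, l.length, by simpa using h2, h4, h3.1, h5, ?_⟩
    have h6 : (c :: l).getLast hne = (fun c => p (mt c))^[l.length] c := by
      rw [List.getLast_eq_getElem]
      simp only [h4, List.getElem_iterate]
      simp
    rw [← h6]
    exact h3.2

theorem Inv.op_of_form (H : Inv mt p Q S) (c : α) (r : ℕ) (hr : 1 ≤ r) (hc : ¬ Q c)
    (h : ∀ i < r, Q (mt ((fun c => p (mt c))^[i] c)))
    (hl : ¬ Q (mt ((fun c => p (mt c))^[r] c))) :
    OP mt Q S (List.iterate (fun c => p (mt c)) c (r + 1)) := by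
  refine ⟨⟨by simp [List.iterate], ?_, ?_⟩, by simp; omega, ?_⟩
  · rw [List.iterate, H.chain]
    simp only [List.length_iterate]
    exact ⟨rfl, h⟩
  · rw [← List.range_map_iterate]
    refine List.Nodup.map_on ?_ List.nodup_range
    have key : ∀ x y, x < y → y < r + 1 →
        (fun c => p (mt c))^[x] c ≠ (fun c => p (mt c))^[y] c := by
      intro x y hxy hy he
      obtain ⟨k, rfl⟩ := Nat.exists_eq_add_of_lt hxy
      rw [show x + k + 1 = x + (k + 1) by ring, Function.iterate_add_apply] at he
      have := (H.nx_inj.iterate x) he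
      rw [Function.iterate_succ_apply'] at this
      apply hc
      rw [this]
      exact (H.Qp _).2 (h k (by omega))
    intro x hx y hy he
    simp only [List.mem_range] at hx hy
    rcases lt_trichotomy x y with h | h | h
    · exact absurd he (key x y h hy)
    · exact h
    · exact absurd he.symm (key y x h hx)
  · intro hne
    refine ⟨by simpa [List.iterate] using hc, ?_⟩
    rw [List.getLast_eq_getElem, List.getElem_iterate]
    simpa using hl

theorem Inv.cp_form (H : Inv mt p Q S) {l : List α} (hl : CP S l) :
    ∃ c, c ∈ Function.periodicPts (fun c => p (mt c)) ∧
      l = List.iterate (fun c => p (mt c)) c (Function.minimalPeriod (fun c => p (mt c)) c) ∧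
      (∀ i, Q (mt ((fun c => p (mt c))^[i] c))) := by
  obtain ⟨⟨hne, hch, hnd⟩, h3⟩ := hl
  cases l with
  | nil => exact absurd rfl hne
  | cons c l =>
    obtain ⟨h4, h5⟩ := (H.chain c l).1 hch
    have h3 := h3 hne
    have h6 : (c :: l).getLast hne = (fun c => p (mt c))^[l.length] c := by
      rw [List.getLast_eq_getElem]
      simp only [h4, List.getElem_iterate]
      simp
    rw [h6, H.hS] at h3
    have hper : Function.IsPeriodicPt (fun c => p (mt c)) (l.length + 1) c := by
      rw [Function.IsPeriodicPt, Function.IsFixedPt, Function.iterate_succ_apply']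
      exact h3.2.symm
    have hmin : Function.minimalPeriod (fun c => p (mt c)) c = l.length + 1 := by
      apply le_antisymm
      · exact hper.minimalPeriod_le (by omega)
      · by_contra hlt
        push Not at hlt
        have hpos : 0 < Function.minimalPeriod (fun c => p (mt c)) c :=
          hper.minimalPeriod_pos (by omega)
        have e1 : (c :: l)[Function.minimalPeriod (fun c => p (mt c)) c]'(by simpa using hlt) =
            (c :: l)[0] := by
          simp only [h4, List.getElem_iterate]
          simp
        have := (List.Nodup.getElem_inj_iff hnd).1 e1
        omega
    refine ⟨c, Function.mk_mem_periodicPts (by omega) hper, by rw [hmin]; exact h4, ?_⟩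
    intro i
    rw [← Function.iterate_mod_minimalPeriod_eq, hmin]
    have hlt : i % (l.length + 1) < l.length + 1 := Nat.mod_lt _ (by omega)
    rcases Nat.lt_succ_iff_lt_or_eq.1 hlt with h | h
    · exact h5 _ h
    · rw [h]; exact h3.1

theorem Inv.cp_of_form (H : Inv mt p Q S) (c : α)
    (hc : c ∈ Function.periodicPts (fun c => p (mt c)))
    (h : ∀ i, Q (mt ((fun c => p (mt c))^[i] c))) :
    CP S (List.iterate (fun c => p (mt c)) c
      (Function.minimalPeriod (fun c => p (mt c)) c)) := by
  have hpos := Function.minimalPeriod_pos_of_mem_periodicPts hc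
  have hit : (fun c => p (mt c))^[Function.minimalPeriod (fun c => p (mt c)) c] c = c :=
    Function.iterate_minimalPeriod
  have hnd : (List.iterate (fun c => p (mt c)) c
      (Function.minimalPeriod (fun c => p (mt c)) c)).Nodup := by
    rw [← List.range_map_iterate]
    refine List.Nodup.map_on ?_ List.nodup_range
    intro x hx y hy he
    exact Function.iterate_injOn_Iio_minimalPeriod (by simpa using hx) (by simpa using hy) he
  obtain ⟨k, hk⟩ := Nat.exists_eq_add_of_lt hpos
  rw [zero_add] at hk
  rw [hk] at hnd hit ⊢
  refine ⟨⟨by simp [List.iterate], ?_, hnd⟩, ?_⟩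
  · rw [List.iterate, H.chain]
    simp only [List.length_iterate]
    exact ⟨rfl, fun i _ => h i⟩
  · intro hne
    rw [List.getLast_eq_getElem, List.getElem_iterate, H.hS]
    refine ⟨h _, ?_⟩
    simp only [List.iterate, List.head_cons, List.length_cons, List.length_iterate,
      Nat.add_sub_cancel]
    rw [Function.iterate_succ_apply'] at hit
    exact hit.symm

theorem Inv.cp_mem (H : Inv mt p Q S) {c d : α}
    (hc : c ∈ Function.periodicPts (fun c => p (mt c))) :
    d ∈ List.iterate (fun c => p (mt c)) c (Function.minimalPeriod (fun c => p (mt c)) c) ↔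
      ∃ i, d = (fun c => p (mt c))^[i] c := by
  rw [List.mem_iterate]
  constructor
  · rintro ⟨m, _, h⟩; exact ⟨m, h⟩
  · rintro ⟨i, h⟩
    refine ⟨i % _, Nat.mod_lt _ (Function.minimalPeriod_pos_of_mem_periodicPts hc), ?_⟩
    rw [Function.iterate_mod_minimalPeriod_eq, h]

theorem Inv.op_tp (H : Inv mt p Q S) {l : List α} (hl : OP mt Q S l) : OP mt Q S (tpA mt l) := by
  obtain ⟨⟨hne, hch, hnd⟩, h2, h3⟩ := hl
  have hinj : Function.Injective mt := fun a b h => by rw [← H.mt_mt a, h, H.mt_mt]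
  refine ⟨⟨by simpa [tpA] using hne, ?_, ?_⟩, by simpa [tpA] using h2, ?_⟩
  · rw [tpA, List.isChain_reverse, List.isChain_map]
    refine hch.imp ?_
    intro a b hab
    rw [H.hS] at hab ⊢
    obtain ⟨h1, rfl⟩ := hab
    rw [H.mt_mt, H.p_p, H.Qp]
    exact ⟨h1, rfl⟩
  · rw [tpA, List.nodup_reverse]
    exact hnd.map hinj
  · intro h
    have h3 := h3 hne
    simp only [tpA, List.head_reverse, List.getLast_reverse, List.getLast_map, List.head_map,
      H.mt_mt]
    exact ⟨h3.2, h3.1⟩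

theorem Inv.cp_tp (H : Inv mt p Q S) {l : List α} (hl : CP S l) : CP S (tpA mt l) := by
  obtain ⟨⟨hne, hch, hnd⟩, h3⟩ := hl
  have hinj : Function.Injective mt := fun a b h => by rw [← H.mt_mt a, h, H.mt_mt]
  have hrev : ∀ a b, S a b → S (mt b) (mt a) := by
    intro a b hab
    rw [H.hS] at hab ⊢
    obtain ⟨h1, rfl⟩ := hab
    rw [H.mt_mt, H.p_p, H.Qp]
    exact ⟨h1, rfl⟩
  refine ⟨⟨by simpa [tpA] using hne, ?_, ?_⟩, ?_⟩
  · rw [tpA, List.isChain_reverse, List.isChain_map]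
    exact hch.imp hrev
  · rw [tpA, List.nodup_reverse]
    exact hnd.map hinj
  · intro h
    have h3 := h3 hne
    simp only [tpA, List.head_reverse, List.getLast_reverse, List.getLast_map, List.head_map]
    exact hrev _ _ h3

/-- Forward closure. -/
theorem Inv.cl1 (H : Inv mt p Q S) {l : List α} (hl : OP mt Q S l ∨ CP S l) {c : α}
    (hc : c ∈ l) (hQ : Q (mt c)) : p (mt c) ∈ l := by
  rcases hl with hl | hl
  · obtain ⟨a, r, hr, rfl, h1, h2, h3⟩ := H.op_form hl
    rw [List.mem_iterate] at hc ⊢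
    obtain ⟨m, hm, rfl⟩ := hc
    refine ⟨m + 1, ?_, ?_⟩
    · rcases Nat.lt_succ_iff_lt_or_eq.1 hm with h | h
      · omega
      · subst h; exact absurd hQ h3
    · rw [Function.iterate_succ_apply']
  · obtain ⟨a, ha, rfl, h2⟩ := H.cp_form hl
    rw [H.cp_mem ha] at hc ⊢
    obtain ⟨m, rfl⟩ := hc
    exact ⟨m + 1, by rw [Function.iterate_succ_apply']⟩

/-- Backward closure. -/
theorem Inv.cl2 (H : Inv mt p Q S) {l : List α} (hl : OP mt Q S l ∨ CP S l) {c : α}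
    (hc : c ∈ l) (hQ : Q c) : mt (p c) ∈ l := by
  rcases hl with hl | hl
  · obtain ⟨a, r, hr, rfl, h1, h2, h3⟩ := H.op_form hl
    rw [List.mem_iterate] at hc ⊢
    obtain ⟨m, hm, rfl⟩ := hc
    cases m with
    | zero => exact absurd hQ h1
    | succ m =>
      refine ⟨m, by omega, ?_⟩
      rw [Function.iterate_succ_apply', H.p_p, H.mt_mt]
  · obtain ⟨a, ha, rfl, h2⟩ := H.cp_form hl
    have hpos := Function.minimalPeriod_pos_of_mem_periodicPts ha
    rw [H.cp_mem ha] at hc ⊢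
    obtain ⟨m, rfl⟩ := hc
    refine ⟨m + (Function.minimalPeriod (fun c => p (mt c)) a - 1), ?_⟩
    have : (fun c => p (mt c))^[m] a = (fun c => p (mt c))^[m + (Function.minimalPeriod (fun c => p (mt c)) a - 1) + 1] a := by
      rw [add_assoc, Nat.sub_add_cancel hpos, Function.iterate_add_minimalPeriod_eq]
    rw [this, Function.iterate_succ_apply', H.p_p, H.mt_mt]

theorem Inv.oo (H : Inv mt p Q S) {l l' : List α} (hl : OP mt Q S l) (hl' : OP mt Q S l') {c : α}
    (hc : c ∈ l) (hc' : c ∈ l') : l = l' := by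
  obtain ⟨a, r, hr, rfl, h1, h2, h3⟩ := H.op_form hl
  obtain ⟨a', r', hr', rfl, h1', h2', h3'⟩ := H.op_form hl'
  rw [List.mem_iterate] at hc hc'
  obtain ⟨i, hi, rfl⟩ := hc
  obtain ⟨j, hj, he⟩ := hc'
  have aux : ∀ (a a' : α) (r' i j : ℕ) (h1 : ¬ Q a)
      (h2' : ∀ i < r', Q (mt ((fun c => p (mt c))^[i] a'))) (hj : j < r' + 1) (hij : i ≤ j)
      (he : (fun c => p (mt c))^[i] a = (fun c => p (mt c))^[j] a'), a = a' := by
    intro a a' r' i j h1 h2' hj hij he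
    obtain ⟨k, rfl⟩ := Nat.exists_eq_add_of_le hij
    rw [Function.iterate_add_apply] at he
    have := (H.nx_inj.iterate i) he
    cases k with
    | zero => exact this
    | succ k =>
      rw [Function.iterate_succ_apply'] at this
      exfalso
      apply h1
      rw [this]
      exact (H.Qp _).2 (h2' k (by omega))
  have haa : a = a' := by
    rcases le_total i j with h | h
    · exact aux a a' r' i j h1 h2' hj h he
    · exact (aux a' a r j i h1' h2 hi h he.symm).symm
  subst haa
  have : r = r' := by
    rcases lt_trichotomy r r' with h | h | h
    · exact absurd (h2' r h) h3
    · exact h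
    · exact absurd (h2 r' h) h3'
  rw [this]

theorem Inv.oc (H : Inv mt p Q S) {l l' : List α} (hl : OP mt Q S l) (hl' : CP S l') {c : α}
    (hc : c ∈ l) (hc' : c ∈ l') : False := by
  obtain ⟨a, r, hr, rfl, h1, h2, h3⟩ := H.op_form hl
  obtain ⟨a', ha, rfl, h2'⟩ := H.cp_form hl'
  rw [List.mem_iterate] at hc
  rw [H.cp_mem ha] at hc'
  obtain ⟨i, hi, rfl⟩ := hc
  obtain ⟨j, he⟩ := hc'
  apply h3
  have : (fun c => p (mt c))^[r] a = (fun c => p (mt c))^[(r - i) + j] a' := by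
    rw [Function.iterate_add_apply, ← he, ← Function.iterate_add_apply]
    congr 1; omega
  rw [this]
  exact h2' _

theorem Inv.cc (H : Inv mt p Q S) {l l' : List α} (hl : CP S l) (hl' : CP S l') {c : α}
    (hc : c ∈ l) (hc' : c ∈ l') : l.IsRotated l' := by
  obtain ⟨a, ha, rfl, h2⟩ := H.cp_form hl
  obtain ⟨a', ha', rfl, h2'⟩ := H.cp_form hl'
  rw [H.cp_mem ha] at hc
  rw [H.cp_mem ha'] at hc'
  obtain ⟨i, rfl⟩ := hc
  obtain ⟨j, he⟩ := hc'
  have h := Function.periodicOrbit_apply_iterate_eq ha i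
  have h' := Function.periodicOrbit_apply_iterate_eq ha' j
  rw [← he, h] at h'
  unfold Function.periodicOrbit at h'
  rw [List.range_map_iterate, List.range_map_iterate] at h'
  exact Quotient.exact h'

theorem Inv.noself (H : Inv mt p Q S) {l : List α} (hl : OP mt Q S l ∨ CP S l) {c : α}
    (hc : c ∈ l) (hc' : mt c ∈ l) : False := by
  have aux : ∀ (d : α) (k : ℕ), (∀ i < k, Q (mt ((fun c => p (mt c))^[i] d))) →
      mt d = (fun c => p (mt c))^[k] d → False := by
    intro d k hk he
    rcases Nat.even_or_odd' k with ⟨e, h | h⟩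
    · have h1 := H.flip e d
      rw [he, h, two_mul, Function.iterate_add_apply] at h1
      exact H.mt_ne _ ((H.nx_inj.iterate e) h1)
    · have h1 := H.flip e d
      rw [he, h, two_mul, add_assoc, Function.iterate_add_apply] at h1
      have h2 := (H.nx_inj.iterate e) h1
      rw [Function.iterate_succ_apply'] at h2
      exact H.p_ne _ (hk e (by omega)) h2.symm
  rcases hl with hl | hl
  · obtain ⟨a, r, hr, rfl, h1, h2, h3⟩ := H.op_form hl
    rw [List.mem_iterate] at hc hc'
    obtain ⟨i, hi, rfl⟩ := hc
    obtain ⟨j, hj, he⟩ := hc'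
    rcases le_total i j with h | h
    · obtain ⟨k, rfl⟩ := Nat.exists_eq_add_of_le h
      refine aux _ k ?_ (by rw [he, add_comm, Function.iterate_add_apply])
      intro t ht
      rw [← Function.iterate_add_apply]
      exact h2 _ (by omega)
    · obtain ⟨k, rfl⟩ := Nat.exists_eq_add_of_le h
      refine aux ((fun c => p (mt c))^[j] a) k ?_ ?_
      · intro t ht
        rw [← Function.iterate_add_apply]
        exact h2 _ (by omega)
      · rw [← Function.iterate_add_apply, add_comm k j, ← he, H.mt_mt]
  · obtain ⟨a, ha, rfl, h2⟩ := H.cp_form hl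
    rw [H.cp_mem ha] at hc hc'
    obtain ⟨i, rfl⟩ := hc
    obtain ⟨j, he⟩ := hc'
    rcases le_total i j with h | h
    · obtain ⟨k, rfl⟩ := Nat.exists_eq_add_of_le h
      refine aux _ k ?_ (by rw [he, add_comm, Function.iterate_add_apply])
      intro t ht
      rw [← Function.iterate_add_apply]
      exact h2 _
    · obtain ⟨k, rfl⟩ := Nat.exists_eq_add_of_le h
      refine aux ((fun c => p (mt c))^[j] a) k ?_ ?_
      · intro t ht
        rw [← Function.iterate_add_apply]
        exact h2 _
      · rw [← Function.iterate_add_apply, add_comm k j, ← he, H.mt_mt]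

theorem mem_tpA (hm : ∀ c, mt (mt c) = c) {l : List α} {c : α} : c ∈ tpA mt l ↔ mt c ∈ l := by
  simp only [tpA, List.mem_reverse, List.mem_map]
  constructor
  · rintro ⟨a, h, rfl⟩; rwa [hm]
  · intro h; exact ⟨_, h, hm c⟩

theorem Inv.exists_open [Finite α] (H : Inv mt p Q S) (a : α) (hQ : ¬ Q a) (hQ' : Q (mt a)) :
    ∃ r, 1 ≤ r ∧ OP mt Q S (List.iterate (fun c => p (mt c)) a (r + 1)) ∧
      (∀ i < r, Q (mt ((fun c => p (mt c))^[i] a))) ∧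
      ¬ Q (mt ((fun c => p (mt c))^[r] a)) := by
  classical
  have ha := H.nx_inj.mem_periodicPts a
  have hpos := Function.minimalPeriod_pos_of_mem_periodicPts ha
  have hex : ∃ r, ¬ Q (mt ((fun c => p (mt c))^[r] a)) := by
    refine ⟨Function.minimalPeriod (fun c => p (mt c)) a - 1, fun h => hQ ?_⟩
    rw [← H.Qp] at h
    have : p (mt ((fun c => p (mt c))^[Function.minimalPeriod (fun c => p (mt c)) a - 1] a)) =
        (fun c => p (mt c))^[Function.minimalPeriod (fun c => p (mt c)) a - 1 + 1] a := by
      rw [Function.iterate_succ_apply']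
    rw [this, Nat.sub_add_cancel hpos, Function.iterate_minimalPeriod] at h
    exact h
  have h1 := Nat.find_spec hex
  have h2 : ∀ i < Nat.find hex, Q (mt ((fun c => p (mt c))^[i] a)) := fun i hi =>
    not_not.1 (Nat.find_min hex hi)
  have h3 : 1 ≤ Nat.find hex := by
    rw [Nat.one_le_iff_ne_zero]
    intro h0
    rw [h0] at h1
    exact h1 hQ'
  exact ⟨_, h3, H.op_of_form a _ h3 hQ h2 h1, h2, h1⟩

theorem Inv.exists_path [Finite α] (H : Inv mt p Q S) (c : α) (hQ : Q c ∨ Q (mt c)) :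
    ∃ l, (OP mt Q S l ∨ CP S l) ∧ (c ∈ l ∨ mt c ∈ l) := by
  classical
  have ha := H.nx_inj.mem_periodicPts c
  by_cases hall : ∀ i, Q (mt ((fun c => p (mt c))^[i] c))
  · exact ⟨_, Or.inr (H.cp_of_form c ha hall), Or.inl ((H.cp_mem ha).2 ⟨0, rfl⟩)⟩
  · push Not at hall
    have h1 := Nat.find_spec hall
    have h2 : ∀ i < Nat.find hall, Q (mt ((fun c => p (mt c))^[i] c)) := fun i hi =>
      not_not.1 (Nat.find_min hall hi)
    set i := Nat.find hall with hi
    have hb : ∀ k < i, Q (mt ((fun c => p (mt c))^[k] (mt ((fun c => p (mt c))^[i] c)))) := by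
      intro k hk
      rw [H.flip' k i hk.le, H.mt_mt, show i - k = (i - k - 1) + 1 by omega,
        Function.iterate_succ_apply', H.Qp]
      exact h2 _ (by omega)
    obtain ⟨r, hr, hop, h3, h4⟩ := H.exists_open (mt ((fun c => p (mt c))^[i] c)) h1 (by
      rcases Nat.eq_zero_or_pos i with h0 | h0
      · rw [h0] at h1 ⊢
        rw [H.mt_mt]
        exact hQ.resolve_right h1
      · exact hb 0 h0)
    refine ⟨_, Or.inl hop, Or.inr ?_⟩
    rw [List.mem_iterate]
    refine ⟨i, ?_, (H.flip i c).symm⟩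
    by_contra hlt
    exact h4 (hb r (by omega))

/-- `R` is a set of representatives of the open paths. -/
def ORep (mt : α → α) (Q : α → Prop) (S : α → α → Prop) (R : Finset (List α)) : Prop :=
  (∀ l ∈ R, OP mt Q S l) ∧
  ∀ l, OP mt Q S l → ∃! l', l' ∈ R ∧ (l = l' ∨ l = tpA mt l')

/-- `R` is a set of representatives of the closed paths. -/
def CRep (mt : α → α) (S : α → α → Prop) (R : Finset (List α)) : Prop :=
  (∀ l ∈ R, CP S l) ∧
  ∀ l, CP S l → ∃! l', l' ∈ R ∧ (l.IsRotated l' ∨ l.IsRotated (tpA mt l'))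

variable {Ro Rc : Finset (List α)}

theorem rep_path (hRo : ORep mt Q S Ro) (hRc : CRep mt S Rc) {l : List α}
    (hl : l ∈ Ro ∨ l ∈ Rc) : OP mt Q S l ∨ CP S l :=
  hl.imp (hRo.1 l) (hRc.1 l)

theorem Inv.U1 (H : Inv mt p Q S) (hRo : ORep mt Q S Ro) (hRc : CRep mt S Rc) {l l' : List α}
    (hl : l ∈ Ro ∨ l ∈ Rc) (hl' : l' ∈ Ro ∨ l' ∈ Rc) {c : α} (hc : c ∈ l) (hc' : c ∈ l') :
    l = l' := by
  rcases hl with hl | hl <;> rcases hl' with hl' | hl'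
  · exact H.oo (hRo.1 _ hl) (hRo.1 _ hl') hc hc'
  · exact (H.oc (hRo.1 _ hl) (hRc.1 _ hl') hc hc').elim
  · exact (H.oc (hRo.1 _ hl') (hRc.1 _ hl) hc' hc).elim
  · have h := H.cc (hRc.1 _ hl) (hRc.1 _ hl') hc hc'
    exact (hRc.2 l (hRc.1 _ hl)).unique ⟨hl, Or.inl (List.IsRotated.refl _)⟩ ⟨hl', Or.inl h⟩

theorem Inv.U2 (H : Inv mt p Q S) (hRo : ORep mt Q S Ro) (hRc : CRep mt S Rc) {l l' : List α}
    (hl : l ∈ Ro ∨ l ∈ Rc) (hl' : l' ∈ Ro ∨ l' ∈ Rc) {c : α} (hc : c ∈ l) (hc' : mt c ∈ l') :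
    False := by
  have hm : mt c ∈ tpA mt l := (mem_tpA H.mt_mt).2 (by rwa [H.mt_mt])
  have key : l = l' := by
    rcases hl with hl | hl <;> rcases hl' with hl' | hl'
    · have h := H.oo (H.op_tp (hRo.1 _ hl)) (hRo.1 _ hl') hm hc'
      exact (hRo.2 l' (hRo.1 _ hl')).unique ⟨hl, Or.inr h.symm⟩ ⟨hl', Or.inl rfl⟩
    · exact (H.oc (H.op_tp (hRo.1 _ hl)) (hRc.1 _ hl') hm hc').elim
    · exact (H.oc (hRo.1 _ hl') (H.cp_tp (hRc.1 _ hl)) hc' hm).elim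
    · have h := H.cc (H.cp_tp (hRc.1 _ hl)) (hRc.1 _ hl') hm hc'
      exact (hRc.2 l' (hRc.1 _ hl')).unique ⟨hl, Or.inr h.symm⟩
        ⟨hl', Or.inl (List.IsRotated.refl _)⟩
  subst key
  exact H.noself (rep_path hRo hRc hl) hc hc'

theorem Inv.Ex [Finite α] (H : Inv mt p Q S) (hRo : ORep mt Q S Ro) (hRc : CRep mt S Rc) {c : α}
    (hQ : Q c ∨ Q (mt c)) : ∃ l, (l ∈ Ro ∨ l ∈ Rc) ∧ (c ∈ l ∨ mt c ∈ l) := by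
  obtain ⟨l, hl | hl, hc⟩ := H.exists_path c hQ
  · obtain ⟨l', ⟨h1, h2⟩, -⟩ := hRo.2 l hl
    refine ⟨l', Or.inl h1, ?_⟩
    rcases h2 with rfl | rfl
    · exact hc
    · rw [mem_tpA H.mt_mt, mem_tpA H.mt_mt, H.mt_mt] at hc
      exact hc.symm
  · obtain ⟨l', ⟨h1, h2⟩, -⟩ := hRc.2 l hl
    refine ⟨l', Or.inr h1, ?_⟩
    rcases h2 with h2 | h2
    · rwa [h2.mem_iff, h2.mem_iff] at hc
    · rw [h2.mem_iff, h2.mem_iff, mem_tpA H.mt_mt, mem_tpA H.mt_mt, H.mt_mt] at hc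
      exact hc.symm

/-- Cells of paths touch the special columns. -/
theorem Inv.touch (H : Inv mt p Q S) {l : List α} (hl : OP mt Q S l ∨ CP S l) {c : α}
    (hc : c ∈ l) : Q c ∨ Q (mt c) := by
  rcases hl with hl | hl
  · obtain ⟨a, r, hr, rfl, h1, h2, h3⟩ := H.op_form hl
    rw [List.mem_iterate] at hc
    obtain ⟨m, hm, rfl⟩ := hc
    cases m with
    | zero => exact Or.inr (h2 0 hr)
    | succ m =>
      left
      rw [Function.iterate_succ_apply', H.Qp]
      exact h2 m (by omega)
  · obtain ⟨a, ha, rfl, h2⟩ := H.cp_form hl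
    rw [H.cp_mem ha] at hc
    obtain ⟨m, rfl⟩ := hc
    exact Or.inr (h2 m)

end

end TabAux

namespace TabAux

section Mg
variable {α : Type} [DecidableEq α] {A : Type} [CommRing A]

/-- Iterated summation over the coordinates in a list. -/
def mg (B : ℕ) : List α → ((α → ℕ) → A) → (α → ℕ) → A
  | [], g, f => g f
  | k :: ks, g, f => ∑ x ∈ Finset.range B, mg B ks g (Function.update f k x)

/-- `g` does not depend on the coordinate `k`. -/
def Ind (g : (α → ℕ) → A) (k : α) : Prop := ∀ f x, g (Function.update f k x) = g f

theorem mg_append (B : ℕ) (l l' : List α) (g : (α → ℕ) → A) (f : α → ℕ) :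
    mg B (l ++ l') g f = mg B l (mg B l' g) f := by
  induction l generalizing f with
  | nil => rfl
  | cons k l ih => simp only [List.cons_append, mg, ih]

theorem mg_mul (B : ℕ) (l : List α) (g h : (α → ℕ) → A) (hg : ∀ k ∈ l, Ind g k) (f : α → ℕ) :
    mg B l (fun f => g f * h f) f = g f * mg B l h f := by
  induction l generalizing f with
  | nil => rfl
  | cons k l ih =>
    simp only [mg]
    rw [Finset.mul_sum]
    refine Finset.sum_congr rfl fun x _ => ?_
    rw [ih (fun k hk => hg k (List.mem_cons_of_mem _ hk)), hg k (by simp)]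

theorem mg_ind (B : ℕ) (l : List α) (g : (α → ℕ) → A) (k : α) (hk : k ∉ l) (hg : Ind g k) :
    Ind (mg B l g) k := by
  induction l with
  | nil => exact hg
  | cons j l ih =>
    intro f x
    simp only [mg]
    refine Finset.sum_congr rfl fun y _ => ?_
    rw [Function.update_comm (by rintro rfl; simp at hk)]
    exact ih (fun h => hk (List.mem_cons_of_mem _ h)) _ _

theorem prod_ind {β : Type} (l : List β) (w : β → (α → ℕ) → A) (k : α) (h : ∀ b ∈ l, Ind (w b) k) :
    Ind (fun f => (l.map fun b => w b f).prod) k := by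
  intro f x
  dsimp only
  congr 1
  refine List.map_congr_left fun b hb => h b hb f x

theorem mg_flat (B : ℕ) {β : Type} (P : List β) (lk : β → List α) (w : β → (α → ℕ) → A)
    (hlk : P.Pairwise fun b b' => List.Disjoint (lk b) (lk b'))
    (hw : P.Pairwise fun b b' => (∀ k ∈ lk b, Ind (w b') k) ∧ ∀ k ∈ lk b', Ind (w b) k)
    (f : α → ℕ) :
    mg B (P.flatMap lk) (fun f => (P.map fun b => w b f).prod) f =
      (P.map fun b => mg B (lk b) (w b) f).prod := by
  induction P generalizing f with
  | nil => rfl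
  | cons b P ih =>
    rw [List.pairwise_cons] at hlk hw
    rw [List.flatMap_cons, mg_append]
    simp only [List.map_cons, List.prod_cons]
    have h1 : mg B (P.flatMap lk) (fun f => w b f * (P.map fun b => w b f).prod) =
        fun f => (P.map fun b => mg B (lk b) (w b) f).prod * w b f := by
      funext f
      rw [mg_mul, ih hlk.2 hw.2, mul_comm]
      intro k hk
      rw [List.mem_flatMap] at hk
      obtain ⟨b', hb', hk⟩ := hk
      exact (hw.1 b' hb').2 k hk
    rw [h1, mg_mul, mul_comm]
    intro k hk
    refine prod_ind _ _ _ fun b' hb' => mg_ind _ _ _ _ ?_ ((hw.1 b' hb').1 k hk)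
    exact fun h => hlk.1 b' hb' hk h

theorem mg_eq_sum [Fintype α] (B : ℕ) (l : List α) (hl : l.Nodup) (g : (α → ℕ) → A) (f : α → ℕ) :
    mg B l g f = ∑ h ∈ Fintype.piFinset (fun k => if k ∈ l then Finset.range B else {f k}),
      g h := by
  induction l generalizing f with
  | nil =>
    simp only [mg, List.not_mem_nil, if_false]
    rw [Fintype.piFinset_singleton, Finset.sum_singleton]
  | cons k l ih =>
    rw [List.nodup_cons] at hl
    simp only [mg]
    rw [← Finset.sum_fiberwise_of_maps_to (g := fun h : α → ℕ => h k) (t := Finset.range B)]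
    · refine Finset.sum_congr rfl fun x hx => ?_
      rw [ih hl.2]
      refine Finset.sum_congr ?_ fun _ _ => rfl
      ext h
      simp only [Fintype.mem_piFinset, Finset.mem_filter]
      constructor
      · intro hh
        have hk := hh k
        simp only [if_neg hl.1, Function.update_self, Finset.mem_singleton] at hk
        refine ⟨fun j => ?_, hk⟩
        by_cases hj : j = k
        · subst hj
          simpa [hk] using hx
        · have := hh j
          simpa [hj] using this
      · rintro ⟨hh, hk⟩ j
        by_cases hj : j = k
        · subst hj
          simp [hl.1, hk]
        · have := hh j
          simpa [hj] using this
    · intro h hh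
      rw [Fintype.mem_piFinset] at hh
      simpa using hh k

end Mg

section Paths
variable {α : Type} [DecidableEq α] {A : Type} [CommRing A]
variable {mt p : α → α} {Q : α → Prop} {S : α → α → Prop}

/-- The factor of an arrow. -/
def EE (mt key : α → α) (mat : α → ℕ → ℕ → A) (c : α) (f : α → ℕ) : A :=
  mat c (f (key c)) (f (key (mt c)))

theorem EE_ind (key : α → α) (mat : α → ℕ → ℕ → A) (c k : α)
    (h1 : key c ≠ k) (h2 : key (mt c) ≠ k) : Ind (EE mt key mat c) k := by
  intro f x
  simp only [EE, Function.update_of_ne h1, Function.update_of_ne h2]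

theorem mg_path (H : Inv mt p Q S) (key : α → α) (hkey : ∀ c, key (p c) = key c)
    (mat : α → ℕ → ℕ → A) (B : ℕ) (hmat : ∀ c i j, B ≤ j → mat c i j = 0)
    (l : List α) (hne : l ≠ []) (hch : l.IsChain S) (hnd : (l.tail.map key).Nodup)
    (h1 : key (l.head hne) ∉ l.tail.map key) (h2 : key (mt (l.getLast hne)) ∉ l.tail.map key)
    (f : α → ℕ) :
    mg B (l.tail.map key) (fun f => (l.map fun c => EE mt key mat c f).prod) f =
      TabSub.matListProd B (l.map mat) (f (key (l.head hne))) (f (key (mt (l.getLast hne)))) := by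
  induction l generalizing f with
  | nil => exact absurd rfl hne
  | cons c l ih =>
    cases l with
    | nil =>
      simp only [List.tail_cons, List.map_nil, mg, List.map_cons, List.prod_cons, List.prod_nil,
        mul_one, TabSub.matListProd, List.head_cons, List.getLast_singleton, EE]
      simp only [mul_ite, mul_one, mul_zero]
      rw [Finset.sum_ite_eq']
      split_ifs with h
      · rfl
      · exact hmat _ _ _ (by simpa using h)
    | cons d l =>
      rw [List.isChain_cons_cons] at hch
      have hcd := hch.1
      rw [H.hS] at hcd
      have hk : key (mt c) = key d := by rw [hcd.2, hkey]
      simp only [List.tail_cons, List.map_cons, List.nodup_cons, List.mem_cons, not_or,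
        List.head_cons] at hnd h1 h2
      have hl2 : (c :: d :: l).getLast hne = (d :: l).getLast (by simp) := by simp
      rw [hl2] at h2 ⊢
      simp only [List.tail_cons, List.map_cons, mg, List.head_cons]
      rw [TabSub.matListProd]
      refine Finset.sum_congr rfl fun x _ => ?_
      have h3 := ih (by simp) hch.2 (by simpa using hnd.2) (by simpa using hnd.1)
        (by simpa using h2.2) (Function.update f (key d) x)
      simp only [List.tail_cons, List.map_cons, List.head_cons, Function.update_self,
        Function.update_of_ne h2.1] at h3
      rw [← h3]
      simp only [List.prod_cons]
      rw [mg_mul]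
      · congr 1
        simp only [EE, hk, Function.update_self, Function.update_of_ne h1.1]
      · intro k hk'
        refine EE_ind _ _ _ _ ?_ ?_
        · rintro rfl; exact h1.2 hk'
        · rintro rfl; rw [hk] at hk'; exact hnd.1 hk'

end Paths
end TabAux

namespace TabAux

section MainAbs
variable {α : Type} [DecidableEq α] {A : Type} [CommRing A]
variable {mt p : α → α} {Q : α → Prop} {S : α → α → Prop} {Ro Rc : Finset (List α)}

/-- Value of an open path. -/
noncomputable def opVal (mt key : α → α) (mat : α → ℕ → ℕ → A) (B : ℕ) (f : α → ℕ) (l : List α) : A :=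
  if h : l ≠ [] then
    TabSub.matListProd B (l.map mat) (f (key (l.head h))) (f (key (mt (l.getLast h))))
  else 0

/-- Value of a closed path. -/
def clVal (mat : α → ℕ → ℕ → A) (B : ℕ) (l : List α) : A :=
  ∑ x ∈ Finset.range B, TabSub.matListProd B (l.map mat) x x

theorem Inv.op_tailQ (H : Inv mt p Q S) {l : List α} (hl : OP mt Q S l) :
    ∀ d ∈ l.tail, Q d := by
  obtain ⟨a, r, hr, rfl, h1, h2, h3⟩ := H.op_form hl
  intro d hd
  rw [List.iterate, List.tail_cons, List.mem_iterate] at hd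
  obtain ⟨m, hm, rfl⟩ := hd
  rw [← Function.iterate_succ_apply (fun c => p (mt c)) m a, Function.iterate_succ_apply', H.Qp]
  exact h2 m hm

theorem Inv.cp_Q (H : Inv mt p Q S) {l : List α} (hl : CP S l) :
    ∀ d ∈ l, Q d := by
  intro d hd
  rcases H.touch (Or.inr hl) hd with h | h
  · exact h
  · obtain ⟨a, ha, rfl, h2⟩ := H.cp_form hl
    have hpos := Function.minimalPeriod_pos_of_mem_periodicPts ha
    rw [H.cp_mem ha] at hd
    obtain ⟨m, rfl⟩ := hd
    have : (fun c => p (mt c))^[m] a = (fun c => p (mt c))^[m + (Function.minimalPeriod (fun c => p (mt c)) a - 1) + 1] a := by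
      rw [add_assoc, Nat.sub_add_cancel hpos, Function.iterate_add_minimalPeriod_eq]
    rw [this, Function.iterate_succ_apply', H.Qp]
    exact h2 _

theorem Inv.prod_split [Fintype α] [DecidablePred Q] (H : Inv mt p Q S) (hRo : ORep mt Q S Ro)
    (hRc : CRep mt S Rc) (tl : α → Bool) (htl : ∀ c, tl (mt c) = !tl c) (E : α → A)
    (hE : ∀ c, E (mt c) = E c) :
    ∏ c ∈ Finset.univ.filter (fun c => tl c = true ∧ (Q c ∨ Q (mt c))), E c =
      ∏ l ∈ Ro ∪ Rc, (l.map E).prod := by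
  have hnd : ∀ l ∈ Ro ∪ Rc, l.Nodup := by
    intro l hl
    rw [Finset.mem_union] at hl
    rcases hl with hl | hl
    · exact (hRo.1 l hl).1.2.2
    · exact (hRc.1 l hl).1.2.2
  have h1 : ∏ l ∈ Ro ∪ Rc, (l.map E).prod = ∏ l ∈ Ro ∪ Rc, ∏ c ∈ l.toFinset, E c := by
    refine Finset.prod_congr rfl fun l hl => ?_
    rw [List.prod_toFinset _ (hnd l hl)]
  rw [h1, ← Finset.prod_biUnion]
  · symm
    refine Finset.prod_bij (fun c _ => if tl c = true then c else mt c) ?_ ?_ ?_ ?_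
    · intro c hc
      simp only [Finset.mem_biUnion, Finset.mem_union, List.mem_toFinset] at hc
      obtain ⟨l, hl, hc⟩ := hc
      have ht := H.touch (rep_path hRo hRc hl) hc
      simp only [Finset.mem_filter, Finset.mem_univ, true_and]
      split_ifs with h
      · exact ⟨h, ht⟩
      · rw [H.mt_mt, htl]
        exact ⟨by simpa using h, ht.symm⟩
    · intro c hc d hd he
      simp only [Finset.mem_biUnion, Finset.mem_union, List.mem_toFinset] at hc hd
      obtain ⟨l, hl, hc⟩ := hc
      obtain ⟨l', hl', hd⟩ := hd
      split_ifs at he with h h' h'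
      · exact he
      · subst he
        exact (H.U2 hRo hRc hl' hl hd hc).elim
      · subst he
        exact (H.U2 hRo hRc hl hl' hc hd).elim
      · rw [← H.mt_mt c, he, H.mt_mt]
    · intro c hc
      simp only [Finset.mem_filter, Finset.mem_univ, true_and] at hc
      obtain ⟨l, hl, h | h⟩ := H.Ex hRo hRc hc.2
      · refine ⟨c, ?_, by simp [hc.1]⟩
        simp only [Finset.mem_biUnion, Finset.mem_union, List.mem_toFinset]
        exact ⟨l, hl, h⟩
      · refine ⟨mt c, ?_, by simp [htl, hc.1, H.mt_mt]⟩
        simp only [Finset.mem_biUnion, Finset.mem_union, List.mem_toFinset]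
        exact ⟨l, hl, h⟩
    · intro c _
      split_ifs
      · rfl
      · rw [hE]
  · intro l hl l' hl' hne
    rw [Function.onFun, Finset.disjoint_left]
    intro c hc hc'
    rw [List.mem_toFinset] at hc hc'
    rw [Finset.mem_coe, Finset.mem_union] at hl hl'
    exact hne (H.U1 hRo hRc hl hl' hc hc')

theorem Inv.main_abs [Fintype α] [DecidablePred Q] (H : Inv mt p Q S) (hRo : ORep mt Q S Ro)
    (hRc : CRep mt S Rc) (tl : α → Bool) (htl : ∀ c, tl (mt c) = !tl c)
    (key : α → α) (hkey : ∀ c, key (p c) = key c)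
    (hkey2 : ∀ c d, key c = key d → c = d ∨ (Q d ∧ c = p d))
    (mat : α → ℕ → ℕ → A) (B : ℕ) (hmat : ∀ c i j, B ≤ j → mat c i j = 0)
    (hsym : ∀ c i j, mat (mt c) i j = mat c j i)
    (K : α → Prop) [DecidablePred K] (hK : ∀ k, K k ↔ ∃ c, Q c ∧ key c = k) (f : α → ℕ) :
    ∑ h ∈ Fintype.piFinset (fun k => if K k then Finset.range B else {f k}),
      ∏ c ∈ Finset.univ.filter (fun c => tl c = true ∧ (Q c ∨ Q (mt c))), EE mt key mat c h =
    (∏ l ∈ Ro, opVal mt key mat B f l) * ∏ l ∈ Rc, clVal mat B l := by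
  classical
  set P := (Ro ∪ Rc).toList with hP
  set lk : List α → List α := fun l => (l.filter (fun c => decide (Q c))).map key with hlk
  set w : List α → (α → ℕ) → A := fun l f => (l.map fun c => EE mt key mat c f).prod with hw
  have hmemP : ∀ l, l ∈ P ↔ l ∈ Ro ∨ l ∈ Rc := by
    intro l; rw [hP, Finset.mem_toList, Finset.mem_union]
  have hPnd : P.Nodup := Finset.nodup_toList _
  have hmemlk : ∀ l k, k ∈ lk l ↔ ∃ d ∈ l, Q d ∧ key d = k := by
    intro l k
    simp [hlk, and_assoc]
  -- interaction of distinct paths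
  have hint : ∀ l l', l ∈ P → l' ∈ P → ∀ c ∈ l, ∀ d ∈ l', Q d → l ≠ l' →
      key c ≠ key d ∧ key (mt c) ≠ key d := by
    intro l l' hl hl' c hc d hd hQ hne
    rw [hmemP] at hl hl'
    have hd' := H.cl2 (rep_path hRo hRc hl') hd hQ
    constructor
    · intro he
      rcases hkey2 _ _ he with rfl | ⟨_, rfl⟩
      · exact hne (H.U1 hRo hRc hl hl' hc hd)
      · exact H.U2 hRo hRc hl hl' hc hd'
    · intro he
      rcases hkey2 _ _ he with rfl | ⟨_, he⟩
      · exact H.U2 hRo hRc hl hl' hc hd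
      · rw [← he, H.mt_mt] at hd'
        exact hne (H.U1 hRo hRc hl hl' hc hd')
  have hlknd : ∀ l ∈ P, (lk l).Nodup := by
    intro l hl
    rw [hmemP] at hl
    have hnd : l.Nodup := by
      rcases hl with hl | hl
      · exact (hRo.1 l hl).1.2.2
      · exact (hRc.1 l hl).1.2.2
    refine List.Nodup.map_on ?_ (hnd.filter _)
    intro c hc d hd he
    simp only [List.mem_filter, decide_eq_true_eq] at hc hd
    rcases hkey2 _ _ he with h | ⟨_, h⟩
    · exact h
    · subst h
      exact (H.U2 hRo hRc hl hl hc.1 (H.cl2 (rep_path hRo hRc hl) hd.1 hd.2)).elim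
  have hdisj : ∀ l ∈ P, ∀ l' ∈ P, l ≠ l' → List.Disjoint (lk l) (lk l') := by
    intro l hl l' hl' hne k hk hk'
    rw [hmemlk] at hk hk'
    obtain ⟨c, hc, _, rfl⟩ := hk
    obtain ⟨d, hd, hQ, he⟩ := hk'
    exact (hint l l' hl hl' c hc d hd hQ hne).1 he.symm
  have hind : ∀ l ∈ P, ∀ l' ∈ P, l ≠ l' → ∀ k ∈ lk l', Ind (w l) k := by
    intro l hl l' hl' hne k hk
    rw [hmemlk] at hk
    obtain ⟨d, hd, hQ, rfl⟩ := hk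
    refine prod_ind _ _ _ fun c hc => ?_
    have := hint l l' hl hl' c hc d hd hQ hne
    exact EE_ind _ _ _ _ this.1 this.2
  have hpw : P.Pairwise fun l l' => l ∈ P ∧ l' ∈ P ∧ l ≠ l' := by
    have := hPnd
    rw [List.Nodup, List.pairwise_iff_getElem] at this
    rw [List.pairwise_iff_getElem]
    intro i j hi hj hij
    exact ⟨List.getElem_mem _, List.getElem_mem _, this i j hi hj hij⟩
  have hLnd : (P.flatMap lk).Nodup := by
    rw [List.nodup_flatMap]
    exact ⟨hlknd, hpw.imp fun h => hdisj _ h.1 _ h.2.1 h.2.2⟩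
  have hLmem : ∀ k, k ∈ P.flatMap lk ↔ K k := by
    intro k
    rw [List.mem_flatMap, hK]
    constructor
    · rintro ⟨l, _, hk⟩
      rw [hmemlk] at hk
      obtain ⟨d, _, h1, h2⟩ := hk
      exact ⟨d, h1, h2⟩
    · rintro ⟨c, hQ, rfl⟩
      obtain ⟨l, hl, h | h⟩ := H.Ex hRo hRc (Or.inl hQ : Q c ∨ Q (mt c))
      · exact ⟨l, (hmemP l).2 hl, (hmemlk _ _).2 ⟨c, h, hQ, rfl⟩⟩
      · have h1 := H.cl1 (rep_path hRo hRc hl) h (by rwa [H.mt_mt])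
        rw [H.mt_mt] at h1
        exact ⟨l, (hmemP l).2 hl, (hmemlk _ _).2 ⟨p c, h1, (H.Qp _).2 hQ, hkey c⟩⟩
  have hsum : ∑ h ∈ Fintype.piFinset (fun k => if K k then Finset.range B else {f k}),
      ∏ c ∈ Finset.univ.filter (fun c => tl c = true ∧ (Q c ∨ Q (mt c))), EE mt key mat c h =
      mg B (P.flatMap lk) (fun f => (P.map fun b => w b f).prod) f := by
    rw [mg_eq_sum _ _ hLnd]
    refine Finset.sum_congr ?_ ?_
    · simp only [hLmem]
    · intro h _
      rw [H.prod_split hRo hRc tl htl (fun c => EE mt key mat c h)]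
      · rw [hP, Finset.prod_map_toList]
      · intro c
        simp only [EE, H.mt_mt, hsym]
  rw [hsum, mg_flat]
  · rw [hP, Finset.prod_map_toList, Finset.prod_union]
    · congr 1
      · refine Finset.prod_congr rfl fun l hl => ?_
        have hop := hRo.1 l hl
        have hne := hop.1.1
        have hlkl : lk l = l.tail.map key := by
          have hQ := H.op_tailQ hop
          have hh := (hop.2.2 hne).1
          cases l with
          | nil => rfl
          | cons c l =>
            simp only [List.head_cons] at hh
            simp only [hlk, List.tail_cons] at hQ ⊢
            rw [List.filter_cons_of_neg (by simpa using hh), List.filter_eq_self.2]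
            intro a ha
            simpa using hQ a ha
        have hQ := H.op_tailQ hop
        have hnotin : ∀ c, ¬ Q c → key c ∉ l.tail.map key := by
          intro c hc hk
          rw [List.mem_map] at hk
          obtain ⟨d, hd, he⟩ := hk
          rcases hkey2 _ _ he.symm with rfl | ⟨h, rfl⟩
          · exact hc (hQ _ hd)
          · exact hc ((H.Qp _).2 h)
        have hnd := hlknd l ((hmemP l).2 (Or.inl hl))
        rw [hlkl] at hnd ⊢
        rw [opVal, dif_pos hne]
        exact mg_path H key hkey mat B hmat l hne hop.1.2.1 hnd
          (hnotin _ (hop.2.2 hne).1) (hnotin _ (hop.2.2 hne).2) f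
      · refine Finset.prod_congr rfl fun l hl => ?_
        have hcp := hRc.1 l hl
        have hne := hcp.1.1
        have hlkl : lk l = l.map key := by
          have hQ := H.cp_Q hcp
          simp only [hlk]
          rw [List.filter_eq_self.2]
          intro a ha
          simpa using hQ a ha
        have hnd := hlknd l ((hmemP l).2 (Or.inr hl))
        have hlast := hcp.2 hne
        rw [H.hS] at hlast
        have hkl : key (mt (l.getLast hne)) = key (l.head hne) := by
          rw [hlast.2, hkey]
        rw [hlkl] at hnd ⊢
        have hcons : l.map key = key (l.head hne) :: l.tail.map key := by
          conv_lhs => rw [← List.cons_head_tail hne]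
          rfl
        rw [hcons] at hnd ⊢
        rw [List.nodup_cons] at hnd
        simp only [mg, clVal]
        refine Finset.sum_congr rfl fun x _ => ?_
        have := mg_path H key hkey mat B hmat l hne hcp.1.2.1 hnd.2
          hnd.1 (by rw [hkl]; exact hnd.1) (Function.update f (key (l.head hne)) x)
        rw [hkl, Function.update_self] at this
        exact this
    · rw [Finset.disjoint_left]
      intro l hl hl'
      have hne := (hRo.1 l hl).1.1
      exact H.oc (hRo.1 l hl) (hRc.1 l hl') (List.head_mem hne) (List.head_mem hne)
  · exact hpw.imp fun h => hdisj _ h.1 _ h.2.1 h.2.2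
  · exact hpw.imp fun h => ⟨hind _ h.2.1 _ h.1 h.2.2.symm, hind _ h.1 _ h.2.1 h.2.2⟩

end MainAbs
end TabAux

namespace TabAux
open TabSub

section Conc
variable {A : Type} [CommRing A] {ι : Type} [Fintype ι] [DecidableEq ι] {n : ι → ℕ} {s : ℕ}
variable {q1 q2 : ι}

theorem cell_ext {c d : TabCell n} (h : c.1 = d.1) (h2 : (c.2 : ℕ) = d.2) : c = d := by
  obtain ⟨i, a⟩ := c
  obtain ⟨j, b⟩ := d
  simp only at h
  subst h
  congr 1
  exact Fin.ext h2

/-- Swap the columns `q1`, `q2`. -/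
def sw (hn : n q1 = n q2) (c : TabCell n) : TabCell n :=
  if h : c.1 = q1 then ⟨q2, Fin.cast ((congrArg n h).trans hn) c.2⟩
  else if h : c.1 = q2 then ⟨q1, Fin.cast ((congrArg n h).trans hn.symm) c.2⟩ else c

/-- Representative of a cell modulo the swap. -/
def ky (hn : n q1 = n q2) (c : TabCell n) : TabCell n :=
  if c.1 = q2 then sw hn c else c

/-- The special columns. -/
def QQ (q1 q2 : ι) (c : TabCell n) : Prop := c.1 = q1 ∨ c.1 = q2

theorem sw_snd (hn : n q1 = n q2) (c : TabCell n) : ((sw hn c).2 : ℕ) = c.2 := by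
  by_cases h1 : c.1 = q1
  · have e : sw hn c = ⟨q2, Fin.cast ((congrArg n h1).trans hn) c.2⟩ := dif_pos h1
    rw [e]; rfl
  · by_cases h2 : c.1 = q2
    · have e : sw hn c = ⟨q1, Fin.cast ((congrArg n h2).trans hn.symm) c.2⟩ :=
        (dif_neg h1).trans (dif_pos h2)
      rw [e]; rfl
    · have e : sw hn c = c := (dif_neg h1).trans (dif_neg h2)
      rw [e]

theorem sw_fst1 (hn : n q1 = n q2) (c : TabCell n) (h : c.1 = q1) : (sw hn c).1 = q2 := by
  unfold sw
  rw [dif_pos h]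

theorem sw_fst2 (hq : q1 ≠ q2) (hn : n q1 = n q2) (c : TabCell n) (h : c.1 = q2) :
    (sw hn c).1 = q1 := by
  unfold sw
  rw [dif_neg (by rw [h]; exact hq.symm), dif_pos h]

theorem sw_other (hn : n q1 = n q2) (c : TabCell n) (h : ¬ QQ q1 q2 c) : sw hn c = c := by
  unfold sw
  unfold QQ at h
  push Not at h
  rw [dif_neg h.1, dif_neg h.2]

theorem ky_snd (hn : n q1 = n q2) (c : TabCell n) : ((ky hn c).2 : ℕ) = c.2 := by
  by_cases h : c.1 = q2
  · have e : ky hn c = sw hn c := if_pos h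
    rw [e]; exact sw_snd hn c
  · have e : ky hn c = c := if_neg h
    rw [e]

theorem ky_fst2 (hq : q1 ≠ q2) (hn : n q1 = n q2) (c : TabCell n) (h : c.1 = q2) :
    (ky hn c).1 = q1 := by
  unfold ky
  rw [if_pos h]
  exact sw_fst2 hq hn c h

theorem ky_of_ne (hn : n q1 = n q2) (c : TabCell n) (h : c.1 ≠ q2) :
    ky hn c = c := by
  unfold ky
  rw [if_neg h]

theorem sw_sw (hq : q1 ≠ q2) (hn : n q1 = n q2) (c : TabCell n) : sw hn (sw hn c) = c := by
  refine cell_ext ?_ (by rw [sw_snd, sw_snd])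
  by_cases h1 : c.1 = q1
  · rw [sw_fst2 hq hn _ (sw_fst1 hn c h1), h1]
  · by_cases h2 : c.1 = q2
    · rw [sw_fst1 hn _ (sw_fst2 hq hn c h2), h2]
    · have : ¬ QQ q1 q2 c := by unfold QQ; tauto
      rw [sw_other hn c this, sw_other hn c this]

theorem QQ_sw (hq : q1 ≠ q2) (hn : n q1 = n q2) (c : TabCell n) :
    QQ q1 q2 (sw hn c) ↔ QQ q1 q2 c := by
  by_cases h : QQ q1 q2 c
  · simp only [h, iff_true]
    rcases h with h | h
    · exact Or.inr (sw_fst1 hn c h)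
    · exact Or.inl (sw_fst2 hq hn c h)
  · rw [sw_other hn c h]

theorem inv_T (T : TabSub A ι n s) (hq : q1 ≠ q2) (hn : n q1 = n q2) :
    Inv (fun c => T.mate c) (sw hn) (QQ q1 q2) (T.Succ q1 q2) where
  mt_mt := T.mate_invol
  mt_ne := T.mate_ne
  p_p := sw_sw hq hn
  Qp := QQ_sw hq hn
  p_ne := by
    intro c h he
    have := congrArg Sigma.fst he
    rcases h with h | h
    · rw [sw_fst1 hn c h, h] at this; exact hq this.symm
    · rw [sw_fst2 hq hn c h, h] at this; exact hq this
  hS := by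
    intro c d
    constructor
    · rintro ⟨h1, h2, h3, h4⟩
      refine ⟨h1, cell_ext ?_ (by rw [sw_snd]; exact h4.symm)⟩
      rcases h1 with h1 | h1
      · rw [sw_fst1 hn _ h1]
        rcases h2 with h2 | h2
        · exact absurd (h1.trans h2.symm) h3
        · exact h2
      · rw [sw_fst2 hq hn _ h1]
        rcases h2 with h2 | h2
        · exact h2
        · exact absurd (h1.trans h2.symm) h3
    · rintro ⟨h1, rfl⟩
      refine ⟨h1, (QQ_sw hq hn _).2 h1, ?_, (sw_snd hn _).symm⟩
      rcases h1 with h1 | h1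
      · rw [sw_fst1 hn _ h1, h1]; exact hq
      · rw [sw_fst2 hq hn _ h1, h1]; exact hq.symm

theorem not_QQ (c : TabCell n) : ¬ QQ q1 q2 c ↔ (c.1 ≠ q1 ∧ c.1 ≠ q2) := by
  unfold QQ; push Not; rfl

theorem open_iff (T : TabSub A ι n s) (l : List (TabCell n)) :
    T.IsOpenPath q1 q2 l ↔ OP (fun c => T.mate c) (QQ q1 q2) (T.Succ q1 q2) l := by
  unfold TabSub.IsOpenPath OP TabSub.IsPath
  simp only [not_QQ]
  rfl

theorem orep_iff (T : TabSub A ι n s) (R : Finset (List (TabCell n)))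
    (h : T.OpenReps q1 q2 R) : ORep (fun c => T.mate c) (QQ q1 q2) (T.Succ q1 q2) R := by
  refine ⟨fun l hl => (open_iff T l).1 (h.1 l hl), fun l hl => ?_⟩
  exact h.2 l ((open_iff T l).2 hl)

theorem crep_iff (T : TabSub A ι n s) (R : Finset (List (TabCell n)))
    (h : T.ClosedReps q1 q2 R) : CRep (fun c => T.mate c) (T.Succ q1 q2) R :=
  ⟨fun l hl => h.1 l hl, fun l hl => h.2 l hl⟩

theorem castEntry_left {a b : ι} (M : Matrix (Fin (n a)) (Fin (n b)) A) (i j : ℕ)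
    (h : n a ≤ i) : castEntry M i j = 0 := by
  unfold castEntry
  rw [dif_neg]
  omega

theorem castEntry_right {a b : ι} (M : Matrix (Fin (n a)) (Fin (n b)) A) (i j : ℕ)
    (h : n b ≤ j) : castEntry M i j = 0 := by
  unfold castEntry
  rw [dif_neg]
  omega

theorem le_dim (a : ι) : n a ≤ dimBound n := by
  unfold dimBound
  exact Finset.single_le_sum (f := fun i => n i) (fun _ _ => Nat.zero_le _) (Finset.mem_univ a)

theorem matOf_zero (T : TabSub A ι n s) (c : TabCell n) (i j : ℕ) (h : dimBound n ≤ j) :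
    T.matOf c i j = 0 := by
  unfold TabSub.matOf
  split_ifs
  · exact castEntry_right _ _ _ ((le_dim _).trans h)
  · exact castEntry_left _ _ _ ((le_dim _).trans h)

theorem matOf_mate (T : TabSub A ι n s) (c : TabCell n) (i j : ℕ) :
    T.matOf (T.mate c) i j = T.matOf c j i := by
  unfold TabSub.matOf
  rw [T.isTail_mate, T.lab_mate]
  cases T.isTail c <;> simp

theorem ky_sw (hq : q1 ≠ q2) (hn : n q1 = n q2) (c : TabCell n) : ky hn (sw hn c) = ky hn c := by
  refine cell_ext ?_ (by rw [ky_snd, ky_snd, sw_snd])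
  by_cases h1 : c.1 = q1
  · rw [ky_fst2 hq hn _ (sw_fst1 hn c h1), ky_of_ne hn c (by rw [h1]; exact hq), h1]
  · by_cases h2 : c.1 = q2
    · rw [ky_fst2 hq hn c h2, ky_of_ne, sw_fst2 hq hn c h2]
      rw [sw_fst2 hq hn c h2]; exact hq
    · have : ¬ QQ q1 q2 c := by unfold QQ; tauto
      rw [sw_other hn c this]

theorem ky_eq (hq : q1 ≠ q2) (hn : n q1 = n q2) (c d : TabCell n) (h : ky hn c = ky hn d) :
    c = d ∨ (QQ q1 q2 d ∧ c = sw hn d) := by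
  unfold ky at h
  split_ifs at h with h1 h2 h2
  · left; rw [← sw_sw hq hn c, h, sw_sw hq hn]
  · right
    subst h
    exact ⟨(QQ_sw hq hn _).2 (Or.inr h1), (sw_sw hq hn _).symm⟩
  · right
    exact ⟨Or.inr h2, h⟩
  · exact Or.inl h

theorem ky_K (hq : q1 ≠ q2) (hn : n q1 = n q2) (k : TabCell n) :
    k.1 = q1 ↔ ∃ c, QQ q1 q2 c ∧ ky hn c = k := by
  constructor
  · intro h
    exact ⟨k, Or.inl h, ky_of_ne hn k (by rw [h]; exact hq)⟩
  · rintro ⟨c, h | h, rfl⟩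
    · rw [ky_of_ne hn c (by rw [h]; exact hq), h]
    · exact ky_fst2 hq hn c h

theorem emb_inj {c d : TabCell (fun i : {i : ι // i ≠ q1 ∧ i ≠ q2} => n i.1)}
    (h : embCell q1 q2 c = embCell q1 q2 d) : c = d := by
  obtain ⟨⟨i, hi⟩, a⟩ := c
  obtain ⟨⟨j, hj⟩, b⟩ := d
  simp only [embCell, Sigma.mk.injEq] at h
  obtain ⟨rfl, h⟩ := h
  rw [eq_of_heq h]

theorem emb_notQ (c : TabCell (fun i : {i : ι // i ≠ q1 ∧ i ≠ q2} => n i.1)) :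
    ¬ QQ q1 q2 (embCell q1 q2 c) := (not_QQ _).2 c.1.2

/-- Inverse of `embCell`. -/
def bk (c : TabCell n) (h : c.1 ≠ q1 ∧ c.1 ≠ q2) :
    TabCell (fun i : {i : ι // i ≠ q1 ∧ i ≠ q2} => n i.1) := ⟨⟨c.1, h⟩, c.2⟩

theorem emb_bk (c : TabCell n) (h : c.1 ≠ q1 ∧ c.1 ≠ q2) : embCell q1 q2 (bk c h) = c := rfl

theorem tilde_prod (T : TabSub A ι n s) (hq : q1 ≠ q2) (hn : n q1 = n q2)
    (Ro : Finset (List (TabCell n))) (hRo : T.OpenReps q1 q2 Ro) {t : ℕ}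
    (D : TabSub A {i : ι // i ≠ q1 ∧ i ≠ q2} (fun i => n i.1) t)
    (hD : IsTilde T q1 q2 Ro D)
    (π : ∀ i : {i : ι // i ≠ q1 ∧ i ≠ q2}, Equiv.Perm (Fin (n i.1)))
    (f : TabCell n → ℕ) (hf : ∀ c, f (embCell q1 q2 c) = (π c.1 c.2 : Fin (n c.1.1)).1) :
    ∏ c ∈ D.tails, D.entry π c =
      (∏ c ∈ Finset.univ.filter (fun c => T.isTail c = true ∧
          ¬ (QQ q1 q2 c ∨ QQ q1 q2 (T.mate c))), EE (fun c => T.mate c) (ky hn) T.matOf c f) *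
      ∏ l ∈ Ro, opVal (fun c => T.mate c) (ky hn) T.matOf (dimBound n) f l := by
  have H := inv_T T hq hn
  have hO := orep_iff T Ro hRo
  obtain ⟨hA, hB, -⟩ := hD
  have hky : ∀ c, ky hn (embCell q1 q2 c) = embCell q1 q2 c := fun c =>
    ky_of_ne hn _ c.1.2.2
  have hent : ∀ c, D.isTail c = true →
      D.entry π c = D.matOf c (f (embCell q1 q2 c)) (f (embCell q1 q2 (D.mate c))) := by
    intro c hc
    unfold TabSub.matOf TabSub.entry
    rw [if_pos hc, hf, hf]
  rw [← Finset.prod_filter_mul_prod_filter_not D.tails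
    (fun c => ¬ QQ q1 q2 (T.mate (embCell q1 q2 c)))]
  congr 1
  · refine Finset.prod_bij (fun c _ => embCell q1 q2 c) ?_ ?_ ?_ ?_
    · intro c hc
      simp only [Finset.mem_filter, TabSub.tails, Finset.mem_univ, true_and] at hc ⊢
      obtain ⟨h1, h2, h3⟩ := hA c ((not_QQ _).1 hc.2)
      refine ⟨by rw [← h1]; exact hc.1, ?_⟩
      have := emb_notQ c
      tauto
    · intro c _ d _ h
      exact emb_inj h
    · intro c hc
      simp only [Finset.mem_filter, TabSub.tails, Finset.mem_univ, true_and, not_or] at hc ⊢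
      have hc' := (not_QQ c).1 hc.2.1
      refine ⟨bk c hc', ⟨?_, ?_⟩, emb_bk c hc'⟩
      · obtain ⟨h1, -⟩ := hA (bk c hc') ((not_QQ _).1 hc.2.2)
        rw [h1]; exact hc.1
      · exact hc.2.2
    · intro c hc
      simp only [Finset.mem_filter, TabSub.tails, Finset.mem_univ, true_and] at hc
      obtain ⟨h1, h2, h3⟩ := hA c ((not_QQ _).1 hc.2)
      rw [hent c hc.1, h3, EE, hky, h2]
      congr 2
      rw [← h2, hky]
  · symm
    have hne : ∀ l ∈ Ro, l ≠ [] := fun l hl => (hO.1 l hl).1.1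
    have hh : ∀ l (hl : l ∈ Ro), (l.head (hne l hl)).1 ≠ q1 ∧ (l.head (hne l hl)).1 ≠ q2 :=
      fun l hl => (not_QQ _).1 ((hO.1 l hl).2.2 (hne l hl)).1
    refine Finset.prod_bij (fun l hl => bk (l.head (hne l hl)) (hh l hl)) ?_ ?_ ?_ ?_
    · intro l hl
      obtain ⟨h1, h2, h3⟩ := hB l hl (hne l hl) (hh l hl)
      simp only [Finset.mem_filter, TabSub.tails, Finset.mem_univ, true_and, not_not]
      refine ⟨h1, ?_⟩
      rw [emb_bk]
      rcases H.touch (Or.inl (hO.1 l hl)) (List.head_mem (hne l hl)) with h | h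
      · exact absurd h ((hO.1 l hl).2.2 (hne l hl)).1
      · exact h
    · intro l hl l' hl' he
      have he' : l.head (hne l hl) = l'.head (hne l' hl') := congrArg (embCell q1 q2) he
      refine H.oo (hO.1 l hl) (hO.1 l' hl') (List.head_mem (hne l hl)) ?_
      rw [he']
      exact List.head_mem _
    · intro c hc
      simp only [Finset.mem_filter, TabSub.tails, Finset.mem_univ, true_and, not_not] at hc
      obtain ⟨r, hr, hop, -, -⟩ := H.exists_open (embCell q1 q2 c) (emb_notQ c) hc.2
      obtain ⟨l, ⟨hl, h⟩, -⟩ := hO.2 _ hop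
      refine ⟨l, hl, ?_⟩
      rcases h with h | h
      · apply emb_inj
        rw [emb_bk]
        subst h
        simp [List.iterate]
      · exfalso
        obtain ⟨h1, h2, h3⟩ := hB l hl (hne l hl) (hh l hl)
        have e : T.mate (l.getLast (hne l hl)) = embCell q1 q2 c := by
          have e1 : (tpA (fun c => T.mate c) l).head? = some (embCell q1 q2 c) := by
            rw [← h]; simp [List.iterate]
          rw [tpA, List.head?_reverse, List.getLast?_map, List.getLast?_eq_getLast_of_ne_nil (hne l hl)] at e1
          simpa using e1
        rw [e] at h2
        have h4 := D.isTail_mate ⟨⟨(l.head (hne l hl)).1, hh l hl⟩, (l.head (hne l hl)).2⟩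
        rw [emb_inj h2, h1, hc.1] at h4
        simp at h4
    · intro l hl
      obtain ⟨h1, h2, h3⟩ := hB l hl (hne l hl) (hh l hl)
      rw [show D.entry π (bk (l.head (hne l hl)) (hh l hl)) = _ from hent _ h1, opVal,
        dif_pos (hne l hl)]
      change _ = D.matOf (⟨⟨(l.head (hne l hl)).1, hh l hl⟩, (l.head (hne l hl)).2⟩) _ _
      rw [h3]
      unfold TabSub.pathMat
      have e1 := hky (bk (l.head (hne l hl)) (hh l hl))
      rw [emb_bk] at e1
      have e2 := hky (D.mate ⟨⟨(l.head (hne l hl)).1, hh l hl⟩, (l.head (hne l hl)).2⟩)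
      rw [h2] at e2
      rw [e1, e2, emb_bk]
      congr 2
      exact h2.symm

theorem tilde_main (T : TabSub A ι n s) (hq : q1 ≠ q2) (hn : n q1 = n q2)
    (Ro Rc : Finset (List (TabCell n))) (hRo : T.OpenReps q1 q2 Ro)
    (hRc : T.ClosedReps q1 q2 Rc) {t : ℕ}
    (D : TabSub A {i : ι // i ≠ q1 ∧ i ≠ q2} (fun i => n i.1) t)
    (hD : IsTilde T q1 q2 Ro D)
    (π : ∀ i : {i : ι // i ≠ q1 ∧ i ≠ q2}, Equiv.Perm (Fin (n i.1)))
    (f : TabCell n → ℕ) (hf : ∀ c, f (embCell q1 q2 c) = (π c.1 c.2 : Fin (n c.1.1)).1) :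
    (∏ c ∈ D.tails, D.entry π c) * trClosed T Rc =
      ∑ h ∈ Fintype.piFinset
        (fun k : TabCell n => if k.1 = q1 then Finset.range (dimBound n) else {f k}),
        ∏ c ∈ T.tails, EE (fun c => T.mate c) (ky hn) T.matOf c h := by
  have H := inv_T T hq hn
  have hmain := H.main_abs (orep_iff T Ro hRo) (crep_iff T Rc hRc) T.isTail T.isTail_mate
    (ky hn) (ky_sw hq hn) (ky_eq hq hn) T.matOf (dimBound n) (matOf_zero T) (matOf_mate T)
    (fun k => k.1 = q1) (ky_K hq hn) f
  rw [tilde_prod T hq hn Ro hRo D hD π f hf, mul_assoc]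
  have e1 : trClosed T Rc = ∏ l ∈ Rc, clVal T.matOf (dimBound n) l := rfl
  rw [e1, ← hmain, Finset.mul_sum]
  refine Finset.sum_congr (by congr!) fun h hh => ?_
  rw [← Finset.prod_filter_mul_prod_filter_not T.tails
    (fun c => (QQ q1 q2 c ∨ QQ q1 q2 (T.mate c))), mul_comm]
  unfold TabSub.tails
  rw [Finset.filter_filter, Finset.filter_filter]
  congr 1
  refine Finset.prod_congr rfl fun c hc => ?_
  simp only [Finset.mem_filter, Finset.mem_univ, true_and, not_or] at hc
  rw [Fintype.mem_piFinset] at hh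
  have hv : ∀ d, ¬ QQ q1 q2 d → h (ky hn d) = f (ky hn d) := by
    intro d hd
    rw [not_QQ] at hd
    rw [ky_of_ne hn d hd.2]
    have := hh d
    rw [if_neg hd.1] at this
    simpa using this
  unfold EE
  rw [hv c hc.2.1, hv _ hc.2.2]

/-- The product over the arrows, evaluated at arbitrary cell values. -/
noncomputable def WW (T : TabSub A ι n s) (u : TabCell n → ℕ) : A :=
  ∏ c ∈ T.tails, castEntry (T.X (T.lab c)) (u c) (u (T.mate c))

theorem tw_prod (T : TabSub A ι n s) (hn : n q1 = n q2) (τ : Equiv.Perm (Fin (n q2)))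
    (h : TabCell n → ℕ) :
    ∏ c ∈ (T.tw q2 τ).tails, EE (fun c => (T.tw q2 τ).mate c) (ky hn) (T.tw q2 τ).matOf c h =
      WW T (fun c => h (ky hn (colPerm n q2 τ c))) := by
  symm
  unfold WW
  refine Finset.prod_bij (fun c _ => colPerm n q2 τ c) ?_ ?_ ?_ ?_
  · intro c hc
    simp only [TabSub.tails, Finset.mem_filter, Finset.mem_univ, true_and] at hc ⊢
    simpa [TabSub.tw, TabSub.permTab] using hc
  · intro c _ d _ he
    exact (colPerm n q2 τ).injective he
  · intro c hc
    refine ⟨(colPerm n q2 τ).symm c, ?_, by simp⟩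
    simp only [TabSub.tails, Finset.mem_filter, Finset.mem_univ, true_and] at hc ⊢
    simpa [TabSub.tw, TabSub.permTab] using hc
  · intro c hc
    simp only [TabSub.tails, Finset.mem_filter, Finset.mem_univ, true_and] at hc
    simp [EE, TabSub.matOf, TabSub.tw, TabSub.permTab, hc]
    rw [Equiv.symm_apply_apply]

end Conc
end TabAux


namespace TabAux
open TabSub

section Fin5
variable {A : Type} [CommRing A] {ι : Type} [Fintype ι] [DecidableEq ι] {n : ι → ℕ} {s : ℕ}
variable {q1 q2 : ι}

theorem colPerm_ne (τ : Equiv.Perm (Fin (n q2))) (c : TabCell n) (h : c.1 ≠ q2) :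
    colPerm n q2 τ c = c := by
  obtain ⟨i, x⟩ := c
  simp only at h
  simp [colPerm, h]

theorem colPerm_eq (τ : Equiv.Perm (Fin (n q2))) (x : Fin (n q2)) :
    colPerm n q2 τ ⟨q2, x⟩ = ⟨q2, τ x⟩ := by
  refine cell_ext rfl ?_
  have e : (if h : q2 = q2 then ((finCongr (congrArg n h)).permCongr.symm τ)
      else Equiv.refl _) = τ := (dif_pos rfl).trans (by ext y; simp)
  exact congrArg (fun p : Equiv.Perm (Fin (n q2)) => (p x).1) e

theorem uv1 (hn : n q1 = n q2) (τ : Equiv.Perm (Fin (n q2))) (h : TabCell n → ℕ)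
    (c : TabCell n) (hc : c.1 ≠ q2) : h (ky hn (colPerm n q2 τ c)) = h c := by
  rw [colPerm_ne τ c hc, ky_of_ne hn c hc]

theorem uv2 (hq : q1 ≠ q2) (hn : n q1 = n q2) (τ : Equiv.Perm (Fin (n q2))) (h : TabCell n → ℕ)
    (x : Fin (n q2)) : h (ky hn (colPerm n q2 τ ⟨q2, x⟩)) = h ⟨q1, Fin.cast hn.symm (τ x)⟩ := by
  rw [colPerm_eq]
  congr 1
  exact cell_ext (ky_fst2 hq hn _ rfl) (by rw [ky_snd]; rfl)

theorem WW_zero (T : TabSub A ι n s) (u : TabCell n → ℕ) (k : TabCell n) (hk : n k.1 ≤ u k) :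
    WW T u = 0 := by
  unfold WW
  by_cases h : T.isTail k = true
  · refine Finset.prod_eq_zero (i := k) (by simp [TabSub.tails, h]) ?_
    apply castEntry_left
    rw [T.colTail_eq k h]
    exact hk
  · have h' : T.isTail (T.mate k) = true := by
      rw [T.isTail_mate]; simpa using h
    refine Finset.prod_eq_zero (i := T.mate k) (by simp [TabSub.tails, h']) ?_
    apply castEntry_right
    rw [T.colHead_eq _ h', T.mate_invol]
    exact hk

/-- The alternating sum over twists. -/
noncomputable def GG (T : TabSub A ι n s) (hn : n q1 = n q2) (h : TabCell n → ℕ) : A :=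
  ∑ τ : Equiv.Perm (Fin (n q2)),
    (Equiv.Perm.sign τ : ℤ) • WW T (fun c => h (ky hn (colPerm n q2 τ c)))

theorem GG_zero (T : TabSub A ι n s) (hq : q1 ≠ q2) (hn : n q1 = n q2) (h : TabCell n → ℕ)
    (x : Fin (n q1)) (hk : n q1 ≤ h ⟨q1, x⟩) : GG T hn h = 0 := by
  unfold GG
  refine Finset.sum_eq_zero fun τ _ => ?_
  rw [WW_zero T _ ⟨q1, x⟩, smul_zero]
  rw [uv1 hn τ h _ hq]
  exact hk

theorem GG_alt (T : TabSub A ι n s) (hq : q1 ≠ q2) (hn : n q1 = n q2) (h : TabCell n → ℕ)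
    (a b : Fin (n q2)) (hab : a ≠ b)
    (he : h ⟨q1, Fin.cast hn.symm a⟩ = h ⟨q1, Fin.cast hn.symm b⟩) : GG T hn h = 0 := by
  unfold GG
  have hu : ∀ τ : Equiv.Perm (Fin (n q2)),
      (fun c => h (ky hn (colPerm n q2 (Equiv.swap a b * τ) c))) =
      fun c => h (ky hn (colPerm n q2 τ c)) := by
    intro τ
    funext c
    by_cases hc : c.1 = q2
    · obtain ⟨i, x⟩ := c
      simp only at hc
      subst hc
      rw [uv2 hq hn _ h, uv2 hq hn _ h, Equiv.Perm.mul_apply]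
      by_cases h1 : τ x = a
      · rw [h1, Equiv.swap_apply_left]; exact he.symm
      · by_cases h2 : τ x = b
        · rw [h2, Equiv.swap_apply_right]; exact he
        · rw [Equiv.swap_apply_of_ne_of_ne h1 h2]
    · rw [uv1 hn _ h _ hc, uv1 hn _ h _ hc]
  refine Finset.sum_involution (fun τ _ => Equiv.swap a b * τ) ?_ ?_ ?_ ?_
  · intro τ _
    rw [hu, Equiv.Perm.sign_mul, Equiv.Perm.sign_swap hab]
    simp
  · intro τ _ _ e
    rw [mul_eq_right, Equiv.swap_eq_one_iff] at e
    exact hab e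
  · intro τ _; exact Finset.mem_univ _
  · intro τ _
    simp [← mul_assoc]

/-- Values prescribed by a permutation on column `q1`. -/
def hm (hn : n q1 = n q2) (f : TabCell n → ℕ) (σ : Equiv.Perm (Fin (n q2))) : TabCell n → ℕ :=
  fun k => if h : k.1 = q1 then (σ (Fin.cast ((congrArg n h).trans hn) k.2)).1 else f k

theorem hm_q1 (hn : n q1 = n q2) (f : TabCell n → ℕ) (σ : Equiv.Perm (Fin (n q2)))
    (x : Fin (n q1)) : hm hn f σ ⟨q1, x⟩ = (σ (Fin.cast hn x)).1 := dif_pos rfl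

theorem hm_ne (hn : n q1 = n q2) (f : TabCell n → ℕ) (σ : Equiv.Perm (Fin (n q2)))
    (k : TabCell n) (h : k.1 ≠ q1) : hm hn f σ k = f k := dif_neg h

theorem sumH (T : TabSub A ι n s) (hq : q1 ≠ q2) (hn : n q1 = n q2) (f : TabCell n → ℕ) :
    ∑ h ∈ Fintype.piFinset
        (fun k : TabCell n => if k.1 = q1 then Finset.range (dimBound n) else {f k}),
        GG T hn h = ∑ σ : Equiv.Perm (Fin (n q2)), GG T hn (hm hn f σ) := by
  symm
  refine Finset.sum_of_injOn (fun σ => hm hn f σ) ?_ ?_ ?_ ?_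
  · intro σ _ σ' _ he
    ext x
    have := congrFun he ⟨q1, Fin.cast hn.symm x⟩
    simp only [hm_q1] at this
    simpa using this
  · intro σ _
    rw [Finset.mem_coe, Fintype.mem_piFinset]
    intro k
    change hm hn f σ k ∈ _
    by_cases hk : k.1 = q1
    · obtain ⟨i, x⟩ := k
      simp only at hk
      subst hk
      rw [if_pos rfl, hm_q1, Finset.mem_range]
      exact lt_of_lt_of_le (Fin.is_lt _) (le_dim q2)
    · rw [if_neg hk, hm_ne _ _ _ _ hk, Finset.mem_singleton]
  · intro h hh hni
    by_contra hG
    rw [Fintype.mem_piFinset] at hh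
    have hlt : ∀ x : Fin (n q1), h ⟨q1, x⟩ < n q1 := by
      intro x
      by_contra hx
      exact hG (GG_zero T hq hn h x (not_lt.1 hx))
    have hinj : Function.Injective
        (fun x : Fin (n q2) => (⟨h ⟨q1, Fin.cast hn.symm x⟩, (hlt _).trans_eq hn⟩ : Fin (n q2))) := by
      intro a b hab
      by_contra hne
      exact hG (GG_alt T hq hn h a b hne (by simpa using hab))
    apply hni
    refine ⟨Equiv.ofBijective _ (Finite.injective_iff_bijective.1 hinj), by simp, ?_⟩
    funext k
    by_cases hk : k.1 = q1
    · obtain ⟨i, x⟩ := k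
      simp only at hk
      subst hk
      simp only [hm_q1]
      rfl
    · simp only [hm_ne hn _ _ k hk]
      have := hh k
      rw [if_neg hk, Finset.mem_singleton] at this
      exact this.symm
  · intro σ _; rfl

/-- Reassemble a tuple of permutations. -/
def asm (hn : n q1 = n q2)
    (π : ∀ i : {i : ι // i ≠ q1 ∧ i ≠ q2}, Equiv.Perm (Fin (n i.1)))
    (σ τ : Equiv.Perm (Fin (n q2))) (i : ι) : Equiv.Perm (Fin (n i)) :=
  if h : i = q1 then (finCongr ((congrArg n h).trans hn)).permCongr.symm σ
  else if h' : i = q2 then (finCongr (congrArg n h')).permCongr.symm (σ * τ)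
  else π ⟨i, h, h'⟩

theorem asm_q1 (hn : n q1 = n q2)
    (π : ∀ i : {i : ι // i ≠ q1 ∧ i ≠ q2}, Equiv.Perm (Fin (n i.1)))
    (σ τ : Equiv.Perm (Fin (n q2))) :
    asm hn π σ τ q1 = (finCongr hn).permCongr.symm σ := dif_pos rfl

theorem asm_q2 (hq : q1 ≠ q2) (hn : n q1 = n q2)
    (π : ∀ i : {i : ι // i ≠ q1 ∧ i ≠ q2}, Equiv.Perm (Fin (n i.1)))
    (σ τ : Equiv.Perm (Fin (n q2))) :
    asm hn π σ τ q2 = σ * τ :=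
  (dif_neg hq.symm).trans ((dif_pos rfl).trans (by ext x; simp))

theorem asm_other (hn : n q1 = n q2)
    (π : ∀ i : {i : ι // i ≠ q1 ∧ i ≠ q2}, Equiv.Perm (Fin (n i.1)))
    (σ τ : Equiv.Perm (Fin (n q2))) (i : ι) (h : i ≠ q1) (h' : i ≠ q2) :
    asm hn π σ τ i = π ⟨i, h, h'⟩ := (dif_neg h).trans (dif_neg h')

theorem asm_bij (hq : q1 ≠ q2) (hn : n q1 = n q2) :
    Function.Bijective (fun p : (∀ i : {i : ι // i ≠ q1 ∧ i ≠ q2}, Equiv.Perm (Fin (n i.1))) ×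
      Equiv.Perm (Fin (n q2)) × Equiv.Perm (Fin (n q2)) => asm hn p.1 p.2.1 p.2.2) := by
  constructor
  · rintro ⟨π, σ, τ⟩ ⟨π', σ', τ'⟩ he
    simp only at he
    have h1 := congrFun he q1
    rw [asm_q1, asm_q1] at h1
    have h1 := (finCongr hn).permCongr.symm.injective h1
    subst h1
    have h2 := congrFun he q2
    rw [asm_q2 hq, asm_q2 hq] at h2
    have h2 := mul_left_cancel h2
    subst h2
    have h3 : π = π' := by
      funext ⟨i, h, h'⟩
      have := congrFun he i
      rwa [asm_other hn _ _ _ i h h', asm_other hn _ _ _ i h h'] at this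
    rw [h3]
  · intro π
    refine ⟨⟨fun i => π i.1, (finCongr hn).permCongr (π q1),
      ((finCongr hn).permCongr (π q1))⁻¹ * π q2⟩, ?_⟩
    funext i
    simp only
    by_cases h : i = q1
    · subst h
      rw [asm_q1, Equiv.symm_apply_apply]
    · by_cases h' : i = q2
      · subst h'
        rw [asm_q2 hq, mul_inv_cancel_left]
      · rw [asm_other hn _ _ _ i h h']

theorem asm_sgn (hq : q1 ≠ q2) (hn : n q1 = n q2)
    (π : ∀ i : {i : ι // i ≠ q1 ∧ i ≠ q2}, Equiv.Perm (Fin (n i.1)))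
    (σ τ : Equiv.Perm (Fin (n q2))) :
    sgnT (asm hn π σ τ) = sgnT (n := fun i : {i : ι // i ≠ q1 ∧ i ≠ q2} => n i.1) π *
      (Equiv.Perm.sign τ : ℤ) := by
  unfold sgnT
  rw [← Finset.prod_filter_mul_prod_filter_not Finset.univ (fun i => i ≠ q1 ∧ i ≠ q2)]
  congr 1
  · rw [Finset.prod_subtype (p := fun i => i ≠ q1 ∧ i ≠ q2) _ (by simp)]
    refine Finset.prod_congr rfl fun i _ => ?_
    rw [asm_other hn _ _ _ i.1 i.2.1 i.2.2]
  · have : (Finset.univ.filter fun i => ¬ (i ≠ q1 ∧ i ≠ q2)) = {q1, q2} := by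
      ext i; simp; tauto
    rw [this, Finset.prod_pair hq, asm_q1, asm_q2 hq, Equiv.Perm.sign_mul]
    have e : Equiv.Perm.sign ((finCongr hn).permCongr.symm σ) = Equiv.Perm.sign σ := by
      rw [Equiv.permCongr_symm, Equiv.Perm.sign_permCongr]
    rw [e]
    rcases Int.units_eq_one_or (Equiv.Perm.sign σ) with h | h <;> rw [h] <;> simp

/-- Values outside the special columns. -/
def f0 (π : ∀ i : {i : ι // i ≠ q1 ∧ i ≠ q2}, Equiv.Perm (Fin (n i.1))) : TabCell n → ℕ :=
  fun k => if h : k.1 ≠ q1 ∧ k.1 ≠ q2 then (π ⟨k.1, h⟩ k.2).1 else 0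

theorem asm_u (hq : q1 ≠ q2) (hn : n q1 = n q2)
    (π : ∀ i : {i : ι // i ≠ q1 ∧ i ≠ q2}, Equiv.Perm (Fin (n i.1)))
    (σ τ : Equiv.Perm (Fin (n q2))) (c : TabCell n) :
    (asm hn π σ τ c.1 c.2).1 = hm hn (f0 π) σ (ky hn (colPerm n q2 τ c)) := by
  obtain ⟨i, x⟩ := c
  by_cases h' : i = q2
  · subst h'
    rw [uv2 hq hn τ (hm hn (f0 π) σ), hm_q1, asm_q2 hq]
    rfl
  · rw [uv1 hn τ (hm hn (f0 π) σ) ⟨i, x⟩ h']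
    by_cases h : i = q1
    · subst h
      rw [hm_q1, asm_q1]
      simp
    · rw [hm_ne _ _ _ _ h]
      simp only
      rw [asm_other hn _ _ _ i h h']
      unfold f0
      rw [dif_pos (show i ≠ q1 ∧ i ≠ q2 from ⟨h, h'⟩)]

theorem final (T : TabSub A ι n s) (hq : q1 ≠ q2) (hn : n q1 = n q2)
    (Ro Rcl : Equiv.Perm (Fin (n q2)) → Finset (List (TabCell n)))
    (hRo : ∀ τ, (T.tw q2 τ).OpenReps q1 q2 (Ro τ))
    (hRcl : ∀ τ, (T.tw q2 τ).ClosedReps q1 q2 (Rcl τ))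
    (D : ∀ τ : Equiv.Perm (Fin (n q2)),
      (t : ℕ) × TabSub A {i : ι // i ≠ q1 ∧ i ≠ q2} (fun i => n i.1) t)
    (hD : ∀ τ, IsTilde (T.tw q2 τ) q1 q2 (Ro τ) (D τ).2) :
    T.bpf0 = ∑ τ : Equiv.Perm (Fin (n q2)),
      (Equiv.Perm.sign τ : ℤ) • ((D τ).2.bpf0 * trClosed (T.tw q2 τ) (Rcl τ)) := by
  have hL : T.bpf0 = ∑ π : ∀ i : ι, Equiv.Perm (Fin (n i)),
      sgnT π • WW T (fun c => (π c.1 c.2).1) := rfl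
  have hR : ∀ τ : Equiv.Perm (Fin (n q2)), (D τ).2.bpf0 * trClosed (T.tw q2 τ) (Rcl τ) =
      ∑ π : (∀ i : {i : ι // i ≠ q1 ∧ i ≠ q2}, Equiv.Perm (Fin (n i.1))),
        sgnT (n := fun i : {i : ι // i ≠ q1 ∧ i ≠ q2} => n i.1) π •
        ∑ h ∈ Fintype.piFinset
        (fun k : TabCell n => if k.1 = q1 then Finset.range (dimBound n) else {f0 π k}),
          WW T (fun c => h (ky hn (colPerm n q2 τ c))) := by
    intro τ
    unfold TabSub.bpf0
    rw [Finset.sum_mul]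
    refine Finset.sum_congr rfl fun π _ => ?_
    rw [smul_mul_assoc]
    congr 1
    rw [tilde_main (T.tw q2 τ) hq hn (Ro τ) (Rcl τ) (hRo τ) (hRcl τ) (D τ).2 (hD τ) π (f0 π)
      (fun c => dif_pos c.1.2)]
    exact Finset.sum_congr rfl fun h _ => tw_prod T hn τ h
  have hR2 : ∑ τ : Equiv.Perm (Fin (n q2)),
      (Equiv.Perm.sign τ : ℤ) • ((D τ).2.bpf0 * trClosed (T.tw q2 τ) (Rcl τ)) =
      ∑ π : (∀ i : {i : ι // i ≠ q1 ∧ i ≠ q2}, Equiv.Perm (Fin (n i.1))),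
        sgnT (n := fun i : {i : ι // i ≠ q1 ∧ i ≠ q2} => n i.1) π •
        ∑ σ : Equiv.Perm (Fin (n q2)), GG T hn (hm hn (f0 π) σ) := by
    simp only [hR, Finset.smul_sum]
    rw [Finset.sum_comm]
    refine Finset.sum_congr rfl fun π _ => ?_
    rw [Finset.sum_comm, ← Finset.smul_sum, ← sumH T hq hn (f0 π), Finset.smul_sum]
    refine Finset.sum_congr rfl fun h _ => ?_
    unfold GG
    rw [Finset.smul_sum]
    exact Finset.sum_congr rfl fun τ _ => smul_comm _ _ _
  rw [hR2, hL, ← (asm_bij hq hn).sum_comp, Fintype.sum_prod_type]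
  refine Finset.sum_congr rfl fun π _ => ?_
  rw [Finset.smul_sum, Fintype.sum_prod_type]
  refine Finset.sum_congr rfl fun σ _ => ?_
  unfold GG
  rw [Finset.smul_sum]
  refine Finset.sum_congr rfl fun τ _ => ?_
  simp only [asm_u hq hn]
  rw [asm_sgn hq hn, mul_smul]

end Fin5
end TabAux


open TabSub in
/-- Decomposition of `bpf⁰`:
`bpf⁰_T(X_1,…,X_s) = Σ_{τ ∈ S_n} sgn(τ) · bpf⁰_{T̃^τ}(X_{T̃^τ}) · tr(T^τ_cl)`. -/
theorem stmt12 (A : Type) [CommRing A] (m s : ℕ) (n : Fin m → ℕ)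
    (T : TabSub A (Fin m) n s)
    (q1 q2 : Fin m) (hq : q1 < q2) (hn : n q1 = n q2)
    -- families of sets of representatives of the open and closed paths of the `T^τ`
    (Ro Rcl : Equiv.Perm (Fin (n q2)) → Finset (List (TabCell n)))
    (hRo : ∀ τ, (T.tw q2 τ).OpenReps q1 q2 (Ro τ))
    (hRcl : ∀ τ, (T.tw q2 τ).ClosedReps q1 q2 (Rcl τ))
    -- a family of tableaux with substitution realizing the `T̃^τ`
    (D : ∀ τ : Equiv.Perm (Fin (n q2)),
      (t : ℕ) × TabSub A {i : Fin m // i ≠ q1 ∧ i ≠ q2} (fun i => n i.1) t)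
    (hD : ∀ τ, IsTilde (T.tw q2 τ) q1 q2 (Ro τ) (D τ).2) :
    T.bpf0 = ∑ τ : Equiv.Perm (Fin (n q2)),
      (Equiv.Perm.sign τ : ℤ) • ((D τ).2.bpf0 * trClosed (T.tw q2 τ) (Rcl τ)) := by
  exact TabAux.final T (ne_of_lt hq) hn Ro Rcl hRo hRcl D hD
end
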